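/- arXiv:1206.6173 — 4 statements merged into one kernel-verified Lean document; each statement's English description precedes it below -/
import Mathlib

section
/- Let m = ⊕_{p<0} g_p be a free fundamental graded Lie algebra of type (n, μ) over ℂ with μ ≥ 3. If X and Y are linearly independent elements of g_{-1}, then ad(X)^μ(Y) = 0, ad(X)^{μ-1}(Y) ≠ 0, ad(Y)(ad(X)^{μ-1}(Y)) = 0, and ad(Y)(ad(X)^{μ-2}(Y)) ≠ 0. -/
open scoped TensorProduct

/-- A ℤ-graded Lie algebra (GLA) structure over `ℂ` on a Lie algebra `L`:
a family of finite-dimensional subspaces forming an internal direct sum and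
compatible with the bracket. -/
structure GLA (L : Type) [LieRing L] [LieAlgebra ℂ L] : Type where
  g : ℤ → Submodule ℂ L
  internal : DirectSum.IsInternal g
  bracket_mem : ∀ p q : ℤ, ∀ x ∈ g p, ∀ y ∈ g q, ⁅x, y⁆ ∈ g (p + q)
  findim : ∀ p : ℤ, FiniteDimensional ℂ (g p)

namespace GLA

variable {L : Type} [LieRing L] [LieAlgebra ℂ L]

/-- A GLA is a fundamental graded Lie algebra (FGLA): it is finite-dimensional,
concentrated in negative degrees, `g₋₁ ≠ 0`, and it is generated by `g₋₁`
(i.e. `g_{p-1} = [g_p, g₋₁]` for all `p < 0`). -/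
structure IsFGLA (G : GLA L) : Prop where
  fd : FiniteDimensional ℂ L
  nonneg : ∀ p : ℤ, 0 ≤ p → G.g p = ⊥
  neg_one_ne_bot : G.g (-1) ≠ ⊥
  generated : ∀ p : ℤ, p < 0 →
    G.g (p - 1) = Submodule.span ℂ {z : L | ∃ x ∈ G.g p, ∃ y ∈ G.g (-1), z = ⁅x, y⁆}

/-- A GLA is of the `μ`-th kind (equivalently, of depth `μ`). -/
def IsOfKind (G : GLA L) (μ : ℕ) : Prop :=
  G.g (-(μ : ℤ)) ≠ ⊥ ∧ ∀ p : ℤ, p < -(μ : ℤ) → G.g p = ⊥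

/-- Transitivity of a GLA. -/
def Transitive (G : GLA L) : Prop :=
  ∀ p : ℤ, 0 ≤ p → ∀ x ∈ G.g p,
    (∀ q : ℤ, q < 0 → ∀ y ∈ G.g q, ⁅x, y⁆ = 0) → x = 0

end GLA

/-- `G` is a free fundamental graded Lie algebra of type `(n, μ)`:
it is an FGLA of the `μ`-th kind with `dim g₋₁ = n`, and every surjective linear map
from `g₋₁` onto the degree `-1` part of an FGLA of the `μ`-th kind extends uniquely
to a graded Lie algebra epimorphism. -/
def IsFreeFGLA {L : Type} [LieRing L] [LieAlgebra ℂ L] (G : GLA L) (n μ : ℕ) : Prop :=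
  G.IsFGLA ∧ G.IsOfKind μ ∧ Module.finrank ℂ (G.g (-1)) = n ∧
  ∀ (L' : Type) [LieRing L'] [LieAlgebra ℂ L'] (G' : GLA L'),
    G'.IsFGLA → G'.IsOfKind μ →
    ∀ φ : (G.g (-1)) →ₗ[ℂ] (G'.g (-1)), Function.Surjective φ →
      ∃! Φ : L →ₗ⁅ℂ⁆ L',
        (∀ p : ℤ, ∀ x ∈ G.g p, Φ x ∈ G'.g p) ∧ Function.Surjective Φ ∧
        ∀ x : G.g (-1), Φ (x : L) = (φ x : L')

/-- A pseudo-product FGLA: an FGLA together with nonzero subspaces `e`, `f` with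
`g₋₁ = e ⊕ f` and `[e,e] = [f,f] = 0`. -/
structure IsPPFGLA {L : Type} [LieRing L] [LieAlgebra ℂ L]
    (G : GLA L) (e f : Submodule ℂ L) : Prop where
  fgla : G.IsFGLA
  e_ne_bot : e ≠ ⊥
  f_ne_bot : f ≠ ⊥
  sup_eq : e ⊔ f = G.g (-1)
  inf_eq : e ⊓ f = ⊥
  lie_ee : ∀ x ∈ e, ∀ y ∈ e, ⁅x, y⁆ = (0 : L)
  lie_ff : ∀ x ∈ f, ∀ y ∈ f, ⁅x, y⁆ = (0 : L)

/-- `(G; e, f)` is a free pseudo-product FGLA of type `(m, n, μ)`. -/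
def IsFreePPFGLA {L : Type} [LieRing L] [LieAlgebra ℂ L] (G : GLA L)
    (e f : Submodule ℂ L) (m n μ : ℕ) : Prop :=
  IsPPFGLA G e f ∧ G.IsOfKind μ ∧
  Module.finrank ℂ e = m ∧ Module.finrank ℂ f = n ∧
  ∀ (L' : Type) [LieRing L'] [LieAlgebra ℂ L'] (G' : GLA L') (e' f' : Submodule ℂ L'),
    IsPPFGLA G' e' f' → G'.IsOfKind μ →
    ∀ φ : (G.g (-1)) →ₗ[ℂ] (G'.g (-1)), Function.Surjective φ →
      (∀ x : L, ∀ hx : x ∈ G.g (-1), x ∈ e → (φ ⟨x, hx⟩ : L') ∈ e') →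
      (∀ x : L, ∀ hx : x ∈ G.g (-1), x ∈ f → (φ ⟨x, hx⟩ : L') ∈ f') →
      ∃! Φ : L →ₗ⁅ℂ⁆ L',
        (∀ p : ℤ, ∀ x ∈ G.g p, Φ x ∈ G'.g p) ∧ Function.Surjective Φ ∧
        ∀ x : G.g (-1), Φ (x : L) = (φ x : L')

/-- `G` (on `LG`, with embedding `ι` of `Lm`) is the prolongation of the FGLA `M`:
`ι` embeds `M` as the negative part of `G`, `G` is transitive, and `G` is maximal among
transitive GLAs with negative part `M`. -/
structure IsProlongation {Lm LG : Type} [LieRing Lm] [LieAlgebra ℂ Lm]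
    [LieRing LG] [LieAlgebra ℂ LG] (M : GLA Lm) (G : GLA LG)
    (ι : Lm →ₗ⁅ℂ⁆ LG) : Prop where
  inj : Function.Injective ι
  graded_neg : ∀ p : ℤ, p < 0 → (M.g p).map ι.toLinearMap = G.g p
  trans : G.Transitive
  max : ∀ (LH : Type) [LieRing LH] [LieAlgebra ℂ LH] (H : GLA LH) (j : Lm →ₗ⁅ℂ⁆ LH),
    Function.Injective j → (∀ p : ℤ, p < 0 → (M.g p).map j.toLinearMap = H.g p) →
    H.Transitive →
    ∃ ψ : LH →ₗ⁅ℂ⁆ LG, Function.Injective ψ ∧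
      (∀ p : ℤ, (H.g p).map ψ.toLinearMap ≤ G.g p) ∧ ψ.comp j = ι

/-- `G` (with embedding `ι`) is the prolongation of the pseudo-product FGLA `(M; e, f)`:
the negative part is `M`, `G` is transitive, the degree-0 part preserves `e` and `f`,
and `G` is maximal among such transitive GLAs. -/
structure IsPPProlongation {Lm LG : Type} [LieRing Lm] [LieAlgebra ℂ Lm]
    [LieRing LG] [LieAlgebra ℂ LG] (M : GLA Lm) (e f : Submodule ℂ Lm) (G : GLA LG)
    (ι : Lm →ₗ⁅ℂ⁆ LG) : Prop where
  inj : Function.Injective ι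
  graded_neg : ∀ p : ℤ, p < 0 → (M.g p).map ι.toLinearMap = G.g p
  trans : G.Transitive
  e_stable : ∀ x ∈ G.g 0, ∀ y ∈ e, ⁅x, ι y⁆ ∈ e.map ι.toLinearMap
  f_stable : ∀ x ∈ G.g 0, ∀ y ∈ f, ⁅x, ι y⁆ ∈ f.map ι.toLinearMap
  max : ∀ (LH : Type) [LieRing LH] [LieAlgebra ℂ LH] (H : GLA LH) (j : Lm →ₗ⁅ℂ⁆ LH),
    Function.Injective j → (∀ p : ℤ, p < 0 → (M.g p).map j.toLinearMap = H.g p) →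
    H.Transitive →
    (∀ x ∈ H.g 0, ∀ y ∈ e, ⁅x, j y⁆ ∈ e.map j.toLinearMap) →
    (∀ x ∈ H.g 0, ∀ y ∈ f, ⁅x, j y⁆ ∈ f.map j.toLinearMap) →
    ∃ ψ : LH →ₗ⁅ℂ⁆ LG, Function.Injective ψ ∧
      (∀ p : ℤ, (H.g p).map ψ.toLinearMap ≤ G.g p) ∧ ψ.comp j = ι

/-- `G` is a finite-dimensional simple graded Lie algebra of type `(A, Pi1)`, where `A`
is the Cartan matrix (with convention `⁅hᵢ, eⱼ⁆ = Aᵢⱼ • eⱼ`) and `Pi1` is the set of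
simple roots of degree one: there is a set of Chevalley generators compatible with the
grading, the generators `eᵢ` (resp. `fᵢ`) having degree `1` (resp. `-1`) for `i ∈ Pi1`
and degree `0` otherwise. -/
def IsSimpleGLAOfType {LG : Type} [LieRing LG] [LieAlgebra ℂ LG] (G : GLA LG)
    {l : ℕ} (A : Matrix (Fin l) (Fin l) ℤ) (Pi1 : Finset (Fin l)) : Prop :=
  FiniteDimensional ℂ LG ∧ LieAlgebra.IsSimple ℂ LG ∧
  ∃ h e f : Fin l → LG,
    LinearIndependent ℂ h ∧ (∀ i, e i ≠ 0) ∧ (∀ i, f i ≠ 0) ∧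
    (∀ i j, ⁅h i, h j⁆ = 0) ∧
    (∀ i, ⁅e i, f i⁆ = h i) ∧ (∀ i j, i ≠ j → ⁅e i, f j⁆ = 0) ∧
    (∀ i j, ⁅h i, e j⁆ = A i j • e j) ∧
    (∀ i j, ⁅h i, f j⁆ = (-(A i j)) • f j) ∧
    LieSubalgebra.lieSpan ℂ LG (Set.range e ∪ Set.range f) = ⊤ ∧
    (∀ i, h i ∈ G.g 0) ∧
    (∀ i, e i ∈ G.g (if i ∈ Pi1 then 1 else 0)) ∧
    (∀ i, f i ∈ G.g (-(if i ∈ Pi1 then 1 else 0)))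

/-- The Cartan matrix of type `A_l` (Bourbaki numbering, 0-indexed). -/
def cartanA (l : ℕ) : Matrix (Fin l) (Fin l) ℤ :=
  Matrix.of fun i j =>
    if i = j then 2
    else if (i : ℕ) + 1 = (j : ℕ) ∨ (j : ℕ) + 1 = (i : ℕ) then -1 else 0

/-- The Cartan matrix of type `B_l` (Bourbaki numbering, 0-indexed; the last simple
root is the short one), with convention `⁅hᵢ, eⱼ⁆ = Aᵢⱼ • eⱼ`, i.e. `Aᵢⱼ = αⱼ(hᵢ)`. -/
def cartanB (l : ℕ) : Matrix (Fin l) (Fin l) ℤ :=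
  Matrix.of fun i j =>
    if i = j then 2
    else if (i : ℕ) = l - 1 ∧ (j : ℕ) + 1 = (i : ℕ) then -2
    else if (i : ℕ) + 1 = (j : ℕ) ∨ (j : ℕ) + 1 = (i : ℕ) then -1 else 0

/-- The Cartan matrix of type `G₂` (Bourbaki numbering, 0-indexed; `α₁` is the short
root), with convention `⁅hᵢ, eⱼ⁆ = Aᵢⱼ • eⱼ`, i.e. `Aᵢⱼ = αⱼ(hᵢ)`. -/
def cartanG2 : Matrix (Fin 2) (Fin 2) ℤ := !![2, -3; -1, 2]

/-- A pseudo-product graded Lie algebra: a transitive GLA whose negative part is an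
FGLA equipped with a pseudo-product structure `(e, f)` preserved by `g₀`. -/
structure IsPseudoProductGLA {L : Type} [LieRing L] [LieAlgebra ℂ L]
    (G : GLA L) (e f : Submodule ℂ L) : Prop where
  trans : G.Transitive
  e_ne_bot : e ≠ ⊥
  f_ne_bot : f ≠ ⊥
  sup_eq : e ⊔ f = G.g (-1)
  inf_eq : e ⊓ f = ⊥
  lie_ee : ∀ x ∈ e, ∀ y ∈ e, ⁅x, y⁆ = (0 : L)
  lie_ff : ∀ x ∈ f, ∀ y ∈ f, ⁅x, y⁆ = (0 : L)
  neg_one_ne_bot : G.g (-1) ≠ ⊥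
  generated : ∀ p : ℤ, p < 0 →
    G.g (p - 1) = Submodule.span ℂ {z : L | ∃ x ∈ G.g p, ∃ y ∈ G.g (-1), z = ⁅x, y⁆}
  depth_bdd : ∃ μ : ℕ, ∀ p : ℤ, p < -(μ : ℤ) → G.g p = ⊥
  e_stable : ∀ x ∈ G.g 0, ∀ y ∈ e, ⁅x, y⁆ ∈ e
  f_stable : ∀ x ∈ G.g 0, ∀ y ∈ f, ⁅x, y⁆ ∈ f

/-- The symmetric square `S²(V)` of a vector space, realized as the subspace of
symmetric tensors in `V ⊗ V`. -/
noncomputable def symSq (V : Type) [AddCommGroup V] [Module ℂ V] : Submodule ℂ (TensorProduct ℂ V V) :=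
  LinearMap.eqLocus (TensorProduct.comm ℂ V V).toLinearMap LinearMap.id

lemma tmul_self_mem_symSq {V : Type} [AddCommGroup V] [Module ℂ V] (x : V) :
    x ⊗ₜ[ℂ] x ∈ symSq V := by
  show (TensorProduct.comm ℂ V V).toLinearMap (x ⊗ₜ[ℂ] x) = LinearMap.id (x ⊗ₜ[ℂ] x)
  simp

/-- The underlying space of the model filiform Lie algebra of depth `m`: the basis vector of
index `0` acts by shifting the basis vectors of index `1, …, m`. -/
def Filiform (m : ℕ) : Type := Fin (m + 1) → ℂ

namespace Filiform

variable {m : ℕ}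

noncomputable instance : AddCommGroup (Filiform m) :=
  inferInstanceAs (AddCommGroup (Fin (m + 1) → ℂ))

noncomputable instance : Module ℂ (Filiform m) :=
  inferInstanceAs (Module ℂ (Fin (m + 1) → ℂ))

instance : FiniteDimensional ℂ (Filiform m) :=
  inferInstanceAs (FiniteDimensional ℂ (Fin (m + 1) → ℂ))

/-- The coordinates of a vector, extended by zero to all natural indices. -/
noncomputable def coord (k : ℕ) : Filiform m →ₗ[ℂ] ℂ where
  toFun f := if h : k < m + 1 then f ⟨k, h⟩ else 0
  map_add' f g := by
    split_ifs
    · rfl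
    · rw [add_zero]
  map_smul' c f := by
    split_ifs
    · rfl
    · rw [smul_zero]

lemma coord_apply (k : ℕ) (f : Filiform m) :
    coord k f = if h : k < m + 1 then f ⟨k, h⟩ else 0 := rfl

/-- The vector with given coordinates. -/
def ofCoord (c : ℕ → ℂ) : Filiform m := fun i => c i

lemma coord_ofCoord (c : ℕ → ℂ) (k : ℕ) :
    coord k (ofCoord c : Filiform m) = if k ≤ m then c k else 0 := by
  simp [coord_apply, ofCoord]

lemma ext_coord {f g : Filiform m} (h : ∀ k ≤ m, coord k f = coord k g) : f = g := by
  funext i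
  have := h i (by omega)
  rwa [coord_apply, coord_apply, dif_pos i.2, dif_pos i.2] at this

noncomputable instance : Bracket (Filiform m) (Filiform m) where
  bracket f g := ofCoord fun k =>
    if 2 ≤ k then coord 0 f * coord (k - 1) g - coord 0 g * coord (k - 1) f else 0

lemma coord_lie (f g : Filiform m) (k : ℕ) :
    coord k ⁅f, g⁆ = if 2 ≤ k ∧ k ≤ m then
      coord 0 f * coord (k - 1) g - coord 0 g * coord (k - 1) f else 0 := by
  change coord k (ofCoord _) = _
  rw [coord_ofCoord]
  split_ifs <;> first | rfl | omega

noncomputable instance : LieRing (Filiform m) where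
  add_lie f g h := ext_coord fun k _ => by
    simp only [coord_lie, map_add]; split_ifs <;> ring
  lie_add f g h := ext_coord fun k _ => by
    simp only [coord_lie, map_add]; split_ifs <;> ring
  lie_self f := ext_coord fun k _ => by
    simp only [coord_lie, map_zero]; split_ifs <;> ring
  leibniz_lie f g h := ext_coord fun k _ => by
    simp only [coord_lie, map_add]; split_ifs <;> first | omega | ring

noncomputable instance : LieAlgebra ℂ (Filiform m) where
  lie_smul c f g := ext_coord fun k _ => by
    simp only [coord_lie, map_smul, smul_eq_mul]; split_ifs <;> ring

/-- The homogeneous component of degree `p`: the basis vector of index `k` has degree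
`-max k 1`. -/
def component (m : ℕ) (p : ℤ) : Submodule ℂ (Filiform m) where
  carrier := {f | ∀ k : ℕ, (max k 1 : ℤ) ≠ -p → coord k f = 0}
  zero_mem' k _ := map_zero _
  add_mem' hf hg k hk := by rw [map_add, hf k hk, hg k hk, add_zero]
  smul_mem' c f hf k hk := by rw [map_smul, hf k hk, smul_zero]

lemma mem_component {p : ℤ} {f : Filiform m} :
    f ∈ component m p ↔ ∀ k : ℕ, (max k 1 : ℤ) ≠ -p → coord k f = 0 := Iff.rfl

lemma component_eq_bot {p : ℤ} (hp : 0 ≤ p ∨ p < -(m : ℤ) ∧ p ≠ -1) : component m p = ⊥ := by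
  refine (Submodule.eq_bot_iff _).2 fun f hf => ext_coord fun k hk => ?_
  rw [map_zero, hf k (by omega)]

lemma lie_mem_component {p q : ℤ} {f g : Filiform m} (hf : f ∈ component m p)
    (hg : g ∈ component m q) : ⁅f, g⁆ ∈ component m (p + q) := by
  intro k hk
  rw [coord_lie]
  split_ifs with h
  · have h₁ : coord 0 f * coord (k - 1) g = 0 := by
      by_cases hp : p = -1
      · rw [hg (k - 1) (by omega), mul_zero]
      · rw [hf 0 (by simp; omega), zero_mul]
    have h₂ : coord 0 g * coord (k - 1) f = 0 := by
      by_cases hq : q = -1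
      · rw [hf (k - 1) (by omega), mul_zero]
      · rw [hg 0 (by simp; omega), zero_mul]
    rw [h₁, h₂, sub_zero]
  · rfl

lemma isInternal_component : DirectSum.IsInternal (component m) := by
  rw [DirectSum.isInternal_submodule_iff_iSupIndep_and_iSup_eq_top]
  constructor
  · rw [iSupIndep_def]
    intro p
    rw [Submodule.disjoint_def]
    intro f hf hf'
    refine ext_coord fun k _ => ?_
    rw [map_zero]
    by_cases hk : (max k 1 : ℤ) = -p
    · have hle : ⨆ (q) (_ : q ≠ p), component m q ≤ LinearMap.ker (coord k) :=
        iSup₂_le fun q hq g hg => hg k (by omega)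
      exact hle hf'
    · exact hf k hk
  · rw [eq_top_iff]
    intro f _
    have hsum : f = ∑ j ∈ Finset.range (m + 1),
        (ofCoord (fun i => if i = j then coord j f else 0) : Filiform m) := by
      refine ext_coord fun k hk => ?_
      simp only [map_sum, coord_ofCoord, hk, if_true]
      rw [Finset.sum_ite_eq, if_pos (Finset.mem_range.2 (by omega))]
    rw [hsum]
    refine Submodule.sum_mem _ fun j _ => Submodule.mem_iSup_of_mem (-(max j 1 : ℤ)) ?_
    intro k hk
    rw [coord_ofCoord, if_neg (show ¬ k = j by rintro rfl; simp at hk), ite_self]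

/-- The model filiform Lie algebra as a graded Lie algebra. -/
noncomputable def gla (m : ℕ) : GLA (Filiform m) where
  g := component m
  internal := isInternal_component
  bracket_mem _ _ _ hx _ hy := lie_mem_component hx hy
  findim _ := inferInstance

/-- The degree `-1` generator acting as a shift. -/
def shiftGen (m : ℕ) : Filiform m := ofCoord fun k => if k = 0 then 1 else 0

/-- The sum of the two standard degree `-1` generators. -/
def sumGen (m : ℕ) : Filiform m := ofCoord fun k => if k ≤ 1 then 1 else 0

lemma shiftGen_mem : shiftGen m ∈ component m (-1) := by
  intro k hk
  rw [shiftGen, coord_ofCoord, if_neg (show ¬ k = 0 by rintro rfl; simp at hk), ite_self]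

lemma sumGen_mem : sumGen m ∈ component m (-1) := by
  intro k hk
  rw [sumGen, coord_ofCoord, if_neg (show ¬ k ≤ 1 by omega), ite_self]

lemma eq_smul_add_smul {f : Filiform m} (hf : f ∈ component m (-1)) :
    f = (coord 0 f - coord 1 f) • shiftGen m + coord 1 f • sumGen m := by
  refine ext_coord fun k hk => ?_
  simp only [map_add, map_smul, shiftGen, sumGen, coord_ofCoord, smul_eq_mul, if_pos hk]
  rcases k with _ | _ | k
  · simp
  · simp
  · rw [hf (k + 2) (by push_cast; omega)]
    simp

lemma isFGLA_gla (m : ℕ) : (gla m).IsFGLA where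
  fd := inferInstance
  nonneg _ hp := component_eq_bot (.inl hp)
  neg_one_ne_bot h := by
    have h₀ : shiftGen m = 0 := (Submodule.eq_bot_iff _).1 h _ shiftGen_mem
    have := congrArg (coord 0) h₀
    simp [shiftGen, coord_ofCoord] at this
  generated p hp := by
    apply le_antisymm
    · intro f hf
      refine Submodule.subset_span
        ⟨ofCoord fun k => if k = 0 then 0 else -coord (k + 1) f, ?_, shiftGen m, shiftGen_mem, ?_⟩
      · intro k hk
        rw [coord_ofCoord]
        split_ifs with h₁ h₂
        · rfl
        · rw [hf (k + 1) (by push_cast; omega), neg_zero]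
        · rfl
      · refine ext_coord fun k hk => ?_
        simp only [coord_lie, shiftGen, coord_ofCoord]
        by_cases h : 2 ≤ k
        · have h₁ : k - 1 + 1 = k := by omega
          have h₂ : k - 1 ≤ m := by omega
          have h₃ : k - 1 ≠ 0 := by omega
          simp [h, hk, h₁, h₂, h₃]
        · rw [if_neg (by omega), hf k (by omega)]
    · rw [Submodule.span_le]
      rintro _ ⟨x, hx, y, hy, rfl⟩
      exact lie_mem_component hx hy

lemma isOfKind_gla (hm : 1 ≤ m) : (gla m).IsOfKind m := by
  refine ⟨fun h => ?_, fun p hp => component_eq_bot ?_⟩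
  · have hmem : (ofCoord fun k => if k = m then 1 else 0 : Filiform m) ∈ component m (-m) := by
      intro k hk
      rw [coord_ofCoord, if_neg (show ¬ k = m by rintro rfl; omega), ite_self]
    have := congrArg (coord m) ((Submodule.eq_bot_iff _).1 h _ hmem)
    simp [coord_ofCoord] at this
  · omega

lemma coord_ad_shiftGen_pow (k i : ℕ) (hi : i ≤ m) :
    coord i (((LieAlgebra.ad ℂ (Filiform m) (shiftGen m)) ^ (k + 1)) (sumGen m)) =
      if i = k + 2 then 1 else 0 := by
  induction k generalizing i with
  | zero =>
    rw [pow_one, LieAlgebra.ad_apply, coord_lie]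
    simp only [shiftGen, sumGen, coord_ofCoord]
    rcases i with _ | _ | _ | i
    · simp
    · simp
    · have : 1 ≤ m := by omega
      simp [hi, this]
    · simp
  | succ k ih =>
    rw [pow_succ', Module.End.mul_apply, LieAlgebra.ad_apply, coord_lie, ih 0 (by omega),
      ih (i - 1) (by omega)]
    simp only [shiftGen, coord_ofCoord]
    split_ifs <;> first | omega | simp

lemma ad_shiftGen_pow_ne_zero (hm : 2 ≤ m) :
    ((LieAlgebra.ad ℂ (Filiform m) (shiftGen m)) ^ (m - 1)) (sumGen m) ≠ 0 := by
  obtain ⟨k, rfl⟩ := Nat.exists_eq_add_of_le' hm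
  intro h
  have := coord_ad_shiftGen_pow (m := k + 2) k (k + 2) le_rfl
  rw [show k + 1 = k + 2 - 1 by omega, h] at this
  simp at this

lemma lie_sumGen_ad_shiftGen_pow_ne_zero (hm : 3 ≤ m) :
    ⁅sumGen m, ((LieAlgebra.ad ℂ (Filiform m) (shiftGen m)) ^ (m - 2)) (sumGen m)⁆ ≠ 0 := by
  obtain ⟨k, rfl⟩ := Nat.exists_eq_add_of_le' hm
  intro h
  have := congrArg (coord (k + 3)) h
  rw [show k + 3 - 2 = k + 1 by omega, coord_lie, coord_ad_shiftGen_pow _ _ (by omega),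
    coord_ad_shiftGen_pow _ _ (by omega)] at this
  simp [sumGen, coord_ofCoord] at this

end Filiform

lemma LieHom.map_ad_pow {R L L' : Type*} [CommRing R] [LieRing L] [LieAlgebra R L] [LieRing L']
    [LieAlgebra R L'] (Φ : L →ₗ⁅R⁆ L') (x y : L) (k : ℕ) :
    Φ (((LieAlgebra.ad R L x) ^ k) y) = ((LieAlgebra.ad R L' (Φ x)) ^ k) (Φ y) := by
  induction k with
  | zero => simp
  | succ k ih =>
    rw [pow_succ', pow_succ', Module.End.mul_apply, Module.End.mul_apply, LieAlgebra.ad_apply,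
      LieAlgebra.ad_apply, LieHom.map_lie, ih]

lemma LinearIndependent.exists_linearMap_apply_eq {K V W ι : Type*} [Field K] [AddCommGroup V]
    [Module K V] [AddCommGroup W] [Module K W] {v : ι → V} (hv : LinearIndependent K v)
    (w : ι → W) : ∃ φ : V →ₗ[K] W, ∀ i, φ (v i) = w i := by
  obtain ⟨φ, hφ⟩ := LinearMap.exists_extend ((Module.Basis.span hv).constr K w)
  refine ⟨φ, fun i => ?_⟩
  have := LinearMap.congr_fun hφ (Module.Basis.span hv i)
  rw [Module.Basis.constr_basis] at this
  simpa [Module.Basis.span_apply] using this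

lemma GLA.ad_pow_mem {L : Type} [LieRing L] [LieAlgebra ℂ L] (G : GLA L) {X Y : L}
    (hX : X ∈ G.g (-1)) (hY : Y ∈ G.g (-1)) (k : ℕ) :
    ((LieAlgebra.ad ℂ L X) ^ k) Y ∈ G.g (-(k + 1 : ℤ)) := by
  induction k with
  | zero => simpa using hY
  | succ k ih =>
    rw [pow_succ', Module.End.mul_apply, LieAlgebra.ad_apply]
    convert G.bracket_mem _ _ _ hX _ ih using 2
    push_cast
    ring

/-- A free FGLA maps to the filiform one with prescribed values on two independent generators. -/
lemma IsFreeFGLA.exists_lieHom_filiform {L : Type} [LieRing L] [LieAlgebra ℂ L] {G : GLA L}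
    {n μ : ℕ} (hμ : 1 ≤ μ) (hfree : IsFreeFGLA G n μ) {X Y : L} (hX : X ∈ G.g (-1))
    (hY : Y ∈ G.g (-1)) (hind : LinearIndependent ℂ ![X, Y]) :
    ∃ Φ : L →ₗ⁅ℂ⁆ Filiform μ, Φ X = Filiform.shiftGen μ ∧ Φ Y = Filiform.sumGen μ := by
  let x : G.g (-1) := ⟨X, hX⟩
  let y : G.g (-1) := ⟨Y, hY⟩
  have hxy : LinearIndependent ℂ ![x, y] := by
    refine LinearIndependent.of_comp (G.g (-1)).subtype ?_
    convert hind using 1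
    funext i
    fin_cases i <;> rfl
  let x' : (Filiform.gla μ).g (-1) := ⟨_, Filiform.shiftGen_mem⟩
  let y' : (Filiform.gla μ).g (-1) := ⟨_, Filiform.sumGen_mem⟩
  obtain ⟨φ, hφ⟩ := hxy.exists_linearMap_apply_eq ![x', y']
  have hφx : φ x = x' := hφ 0
  have hφy : φ y = y' := hφ 1
  have hsurj : Function.Surjective φ := fun z =>
    ⟨(Filiform.coord 0 (z : Filiform μ) - Filiform.coord 1 (z : Filiform μ)) • x +
      Filiform.coord 1 (z : Filiform μ) • y, by
      rw [map_add, map_smul, map_smul, hφx, hφy]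
      exact Subtype.ext (Filiform.eq_smul_add_smul z.2).symm⟩
  obtain ⟨Φ, ⟨-, -, hΦ⟩, -⟩ := hfree.2.2.2 (Filiform μ) (Filiform.gla μ)
    (Filiform.isFGLA_gla μ) (Filiform.isOfKind_gla hμ) φ hsurj
  exact ⟨Φ, by rw [hΦ x, hφx], by rw [hΦ y, hφy]⟩

/-- In a free FGLA of type `(n, μ)` with `μ ≥ 3`, for linearly independent
`X, Y ∈ g₋₁` one has `ad(X)^μ Y = 0`, `ad(X)^{μ-1} Y ≠ 0`,
`ad(Y) ad(X)^{μ-1} Y = 0` and `ad(Y) ad(X)^{μ-2} Y ≠ 0`. -/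
theorem free_fgla_ad_powers {L : Type} [LieRing L] [LieAlgebra ℂ L]
    (G : GLA L) (n μ : ℕ) (hμ : 3 ≤ μ) (hfree : IsFreeFGLA G n μ)
    (X Y : L) (hX : X ∈ G.g (-1)) (hY : Y ∈ G.g (-1))
    (hind : LinearIndependent ℂ ![X, Y]) :
    ((LieAlgebra.ad ℂ L X) ^ μ) Y = 0 ∧
    ((LieAlgebra.ad ℂ L X) ^ (μ - 1)) Y ≠ 0 ∧
    (LieAlgebra.ad ℂ L Y) (((LieAlgebra.ad ℂ L X) ^ (μ - 1)) Y) = 0 ∧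
    (LieAlgebra.ad ℂ L Y) (((LieAlgebra.ad ℂ L X) ^ (μ - 2)) Y) ≠ 0 := by
  have hzero : ∀ z ∈ G.g (-(μ + 1 : ℤ)), z = 0 := fun z hz =>
    (Submodule.eq_bot_iff _).1 (hfree.2.1.2 _ (by omega)) z hz
  obtain ⟨Φ, hΦX, hΦY⟩ := hfree.exists_lieHom_filiform (by omega) hX hY hind
  refine ⟨hzero _ (G.ad_pow_mem hX hY μ), fun h => ?_, hzero _ ?_, fun h => ?_⟩
  · have := congrArg Φ h
    rw [Φ.map_ad_pow, hΦX, hΦY, map_zero] at this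
    exact Filiform.ad_shiftGen_pow_ne_zero (by omega) this
  · rw [LieAlgebra.ad_apply]
    convert G.bracket_mem _ _ _ hY _ (G.ad_pow_mem hX hY (μ - 1)) using 2
    omega
  · have := congrArg Φ h
    rw [LieAlgebra.ad_apply, LieHom.map_lie, Φ.map_ad_pow, hΦX, hΦY, map_zero] at this
    exact Filiform.lie_sumGen_ad_shiftGen_pow_ne_zero hμ this
end

section
/- Let m = ⊕_{p<0} g_p be a free fundamental graded Lie algebra over ℂ and let g(m) = ⊕_{p∈ℤ} g(m)_p be the prolongation of m. Then the map g(m)_0 → gl(g_{-1}) given by D ↦ D|g_{-1} is a Lie algebra isomorphism. -/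
open scoped TensorProduct

namespace LieAlgebra

/-- The tangent Lie algebra `L ⊗ ℂ[ε]` of `L`, where a pair `(x, a)` stands for `x + ε a`. -/
@[ext] structure Tangent (L : Type) : Type where
  base : L
  vec : L

namespace Tangent

section Ring

variable {L : Type} [LieRing L]

/-- The underlying pair of an element of the tangent Lie algebra. -/
def toProd (L : Type) : Tangent L ≃ L × L where
  toFun x := (x.base, x.vec)
  invFun x := ⟨x.1, x.2⟩

instance : AddCommGroup (Tangent L) := (toProd L).addCommGroup

instance : Bracket (Tangent L) (Tangent L) where
  bracket x y := ⟨⁅x.base, y.base⁆, ⁅x.base, y.vec⁆ + ⁅x.vec, y.base⁆⟩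

@[simp] lemma base_zero : (0 : Tangent L).base = 0 := rfl
@[simp] lemma vec_zero : (0 : Tangent L).vec = 0 := rfl
@[simp] lemma base_add (x y : Tangent L) : (x + y).base = x.base + y.base := rfl
@[simp] lemma vec_add (x y : Tangent L) : (x + y).vec = x.vec + y.vec := rfl
@[simp] lemma base_lie (x y : Tangent L) : ⁅x, y⁆.base = ⁅x.base, y.base⁆ := rfl
@[simp] lemma vec_lie (x y : Tangent L) :
    ⁅x, y⁆.vec = ⁅x.base, y.vec⁆ + ⁅x.vec, y.base⁆ := rfl

instance : LieRing (Tangent L) where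
  add_lie x y z := by ext <;> simp; abel
  lie_add x y z := by ext <;> simp; abel
  lie_self x := by
    ext <;> simp
    rw [← lie_skew, neg_add_cancel]
  leibniz_lie x y z := by
    ext
    · simp
    · simp only [vec_lie, vec_add, base_lie, lie_add, add_lie]
      rw [leibniz_lie x.base y.base z.vec, leibniz_lie x.base y.vec z.base,
        leibniz_lie x.vec y.base z.base]
      abel

end Ring

variable {L : Type} [LieRing L] [LieAlgebra ℂ L]

instance : Module ℂ (Tangent L) := (toProd L).module ℂ

@[simp] lemma base_smul (c : ℂ) (x : Tangent L) : (c • x).base = c • x.base := rfl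
@[simp] lemma vec_smul (c : ℂ) (x : Tangent L) : (c • x).vec = c • x.vec := rfl

instance : LieAlgebra ℂ (Tangent L) where
  lie_smul c x y := by ext <;> simp

/-- The projection of the tangent Lie algebra onto its base. -/
def baseHom (L : Type) [LieRing L] [LieAlgebra ℂ L] : Tangent L →ₗ⁅ℂ⁆ L where
  toFun := base
  map_add' _ _ := rfl
  map_smul' _ _ := rfl
  map_lie' := rfl

/-- The tangent-vector component, as a linear map. -/
def vecHom (L : Type) [LieRing L] [LieAlgebra ℂ L] : Tangent L →ₗ[ℂ] L where
  toFun := vec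
  map_add' _ _ := rfl
  map_smul' _ _ := rfl

@[simp] lemma baseHom_apply (x : Tangent L) : baseHom L x = x.base := rfl
@[simp] lemma vecHom_apply (x : Tangent L) : vecHom L x = x.vec := rfl

instance [FiniteDimensional ℂ L] : FiniteDimensional ℂ (Tangent L) :=
  FiniteDimensional.of_injective ((baseHom L).toLinearMap.prod (vecHom L)) fun x y h => by
    exact Tangent.ext (congrArg Prod.fst h) (congrArg Prod.snd h)

end Tangent

end LieAlgebra

namespace GLA

open LieAlgebra

section Generated

variable {N : Type} [LieRing N] [LieAlgebra ℂ N]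

/-- The span of the left-normed brackets of `k + 1` elements of `V`. -/
def genPart (V : Submodule ℂ N) : ℕ → Submodule ℂ N
  | 0 => V
  | k + 1 => Submodule.span ℂ {z : N | ∃ x ∈ genPart V k, ∃ y ∈ V, z = ⁅x, y⁆}

lemma lie_mem_genPart (V : Submodule ℂ N) {i j : ℕ} {x y : N} (hx : x ∈ genPart V i)
    (hy : y ∈ genPart V j) : ⁅x, y⁆ ∈ genPart V (i + j + 1) := by
  induction j generalizing i x y with
  | zero => exact Submodule.subset_span ⟨x, hx, y, hy, rfl⟩
  | succ j ih =>
    simp only [genPart] at hy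
    induction hy using Submodule.span_induction with
    | mem y hy =>
      obtain ⟨y', hy', v, hv, rfl⟩ := hy
      rw [leibniz_lie, ← lie_skew y' ⁅x, v⁆, ← sub_eq_add_neg]
      refine sub_mem (Submodule.subset_span ⟨_, ih hx hy', v, hv, rfl⟩) ?_
      have hxv : ⁅x, v⁆ ∈ genPart V (i + 1) := Submodule.subset_span ⟨x, hx, v, hv, rfl⟩
      convert ih hxv hy' using 1
      congr 1
      omega
    | zero => simp
    | add a b _ _ ha hb => rw [lie_add]; exact add_mem ha hb
    | smul c a _ ha => rw [lie_smul]; exact Submodule.smul_mem _ _ ha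

/-- The family `genPart V`, indexed by negative integers with `V` in degree `-1`. -/
def genGrade (V : Submodule ℂ N) : ℤ → Submodule ℂ N
  | Int.ofNat _ => ⊥
  | Int.negSucc k => genPart V k

lemma lie_mem_genGrade (V : Submodule ℂ N) {p q : ℤ} {x y : N} (hx : x ∈ genGrade V p)
    (hy : y ∈ genGrade V q) : ⁅x, y⁆ ∈ genGrade V (p + q) := by
  cases p with
  | ofNat i => rw [(Submodule.mem_bot ℂ).1 hx, zero_lie]; exact zero_mem _
  | negSucc i =>
    cases q with
    | ofNat j => rw [(Submodule.mem_bot ℂ).1 hy, lie_zero]; exact zero_mem _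
    | negSucc j => exact lie_mem_genPart V hx hy

/-- The Lie subalgebra generated by `V`, as the sum of the spaces `genGrade V p`. -/
def genSubalgebra (V : Submodule ℂ N) : LieSubalgebra ℂ N where
  __ := ⨆ p, genGrade V p
  lie_mem' {x y} hx hy := by
    change x ∈ ⨆ p, genGrade V p at hx
    change y ∈ ⨆ p, genGrade V p at hy
    change ⁅x, y⁆ ∈ ⨆ p, genGrade V p
    induction hx using Submodule.iSup_induction' with
    | mem p x hx =>
      induction hy using Submodule.iSup_induction' with
      | mem q y hy => exact Submodule.mem_iSup_of_mem _ (lie_mem_genGrade V hx hy)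
      | zero => simp
      | add a b _ _ ha hb => rw [lie_add]; exact add_mem ha hb
    | zero => simp
    | add a b _ _ ha hb => rw [add_lie]; exact add_mem ha hb

lemma genGrade_le (V : Submodule ℂ N) (p : ℤ) :
    genGrade V p ≤ (genSubalgebra V).toSubmodule := le_iSup (genGrade V) p

lemma map_comap_genGrade (V : Submodule ℂ N) (p : ℤ) :
    ((genGrade V p).comap (genSubalgebra V).toSubmodule.subtype).map
      (genSubalgebra V).toSubmodule.subtype = genGrade V p := by
  rw [Submodule.map_comap_subtype, inf_eq_right.2 (genGrade_le V p)]

/-- The subalgebra generated by `V`, graded with `V` in degree `-1`. -/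
def generatedBy [FiniteDimensional ℂ N] (V : Submodule ℂ N) (h : iSupIndep (genGrade V)) :
    GLA (genSubalgebra V) where
  g p := (genGrade V p).comap (genSubalgebra V).toSubmodule.subtype
  internal := by
    refine DirectSum.isInternal_submodule_of_iSupIndep_of_iSup_eq_top ?_ ?_
    · rw [iSupIndep_iff_finsetSum_eq_zero_imp_eq_zero] at h ⊢
      intro s v hv hs i hi
      have := h s (fun i => (v i : N)) hv
        (by simpa using congrArg (Subtype.val : genSubalgebra V → N) hs) i hi
      exact Subtype.ext this
    · apply Submodule.map_injective_of_injective (genSubalgebra V).toSubmodule.injective_subtype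
      rw [Submodule.map_iSup, Submodule.map_top, Submodule.range_subtype]
      exact iSup_congr fun p => map_comap_genGrade V p
  bracket_mem p q x hx y hy := lie_mem_genGrade V hx hy
  findim p := inferInstance

lemma generatedBy_isFGLA [FiniteDimensional ℂ N] (V : Submodule ℂ N)
    (h : iSupIndep (genGrade V)) (hV : V ≠ ⊥) : (generatedBy V h).IsFGLA where
  fd := inferInstanceAs (FiniteDimensional ℂ (genSubalgebra V).toSubmodule)
  nonneg p hp := by
    obtain ⟨k, rfl⟩ := Int.eq_ofNat_of_zero_le hp
    rw [eq_bot_iff]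
    exact fun x hx => Subtype.ext ((Submodule.mem_bot ℂ).1 hx)
  neg_one_ne_bot hbot := by
    apply hV
    rw [← show genGrade V (-1) = V from rfl, ← map_comap_genGrade V (-1)]
    change ((generatedBy V h).g (-1)).map _ = ⊥
    rw [hbot, Submodule.map_bot]
  generated p hp := by
    obtain ⟨k, rfl⟩ := Int.eq_negSucc_of_lt_zero hp
    apply Submodule.map_injective_of_injective (genSubalgebra V).toSubmodule.injective_subtype
    refine (map_comap_genGrade V (Int.negSucc (k + 1))).trans ?_
    rw [Submodule.map_span]
    change Submodule.span ℂ _ = _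
    congr 1
    ext z
    constructor
    · rintro ⟨x, hx, y, hy, rfl⟩
      exact ⟨⁅(⟨x, genGrade_le V (Int.negSucc k) hx⟩ : genSubalgebra V),
        ⟨y, genGrade_le V (Int.negSucc 0) hy⟩⁆, ⟨_, hx, _, hy, rfl⟩, rfl⟩
    · rintro ⟨_, ⟨x, hx, y, hy, rfl⟩, rfl⟩
      exact ⟨x, hx, y, hy, rfl⟩

end Generated

variable {L : Type} [LieRing L] [LieAlgebra ℂ L] {G : GLA L}

lemma IsFGLA.iSup_le_of_neg_one (hG : G.IsFGLA) {S : Submodule ℂ L}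
    (h₁ : G.g (-1) ≤ S) (h : ∀ x ∈ S, ∀ y ∈ G.g (-1), ⁅x, y⁆ ∈ S) : S = ⊤ := by
  rw [eq_top_iff, ← G.internal.submodule_iSup_eq_top, iSup_le_iff]
  have key : ∀ k : ℕ, G.g (Int.negSucc k) ≤ S := fun k => by
    induction k with
    | zero => exact h₁
    | succ k ih =>
      rw [← show Int.negSucc k - 1 = Int.negSucc (k + 1) from rfl,
        hG.generated _ (Int.negSucc_lt_zero k), Submodule.span_le]
      rintro _ ⟨x, hx, y, hy, rfl⟩
      exact h x (ih hx) y hy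
  intro p
  cases p with
  | ofNat k => exact (hG.nonneg k (Int.natCast_nonneg k)).trans_le bot_le
  | negSucc k => exact key k

/-- The homogeneous derivations of degree zero of a graded Lie algebra. -/
def derZero (G : GLA L) : LieSubalgebra ℂ (LieDerivation ℂ L L) where
  carrier := {D | ∀ p, ∀ x ∈ G.g p, D x ∈ G.g p}
  zero_mem' _ _ _ := zero_mem _
  add_mem' hD hE p x hx := add_mem (hD p x hx) (hE p x hx)
  smul_mem' c _ hD p x hx := Submodule.smul_mem _ c (hD p x hx)
  lie_mem' hD hE p x hx := by
    rw [LieDerivation.lie_apply]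
    exact sub_mem (hD p _ (hE p x hx)) (hE p _ (hD p x hx))

/-- The semidirect sum of a graded Lie algebra with its derivations of degree zero. -/
abbrev DerExt (G : GLA L) : Type := L ⋊⁅G.derZero.incl⁆ G.derZero

/-- The grading of `DerExt G` with the derivations in degree zero. -/
def derExt (G : GLA L) [FiniteDimensional ℂ L] : GLA G.DerExt where
  g p :=
    { carrier := {z | z.left ∈ G.g p ∧ (p ≠ 0 → z.right = 0)}
      zero_mem' := ⟨zero_mem _, fun _ => rfl⟩
      add_mem' := fun ha hb => ⟨add_mem ha.1 hb.1, fun hp => by simp [ha.2 hp, hb.2 hp]⟩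
      smul_mem' := fun c _ ha =>
        ⟨Submodule.smul_mem _ c ha.1, fun hp => by simp [ha.2 hp]⟩ }
  internal := by
    refine DirectSum.isInternal_submodule_of_iSupIndep_of_iSup_eq_top ?_ ?_
    · have h := G.internal.submodule_iSupIndep
      rw [iSupIndep_iff_finsetSum_eq_zero_imp_eq_zero] at h ⊢
      intro s v hv hs i hi
      have hl := h s (fun i => (v i).left) (fun i hi => (hv i hi).1)
        (by simpa [map_sum] using congrArg (SemiDirectSum.projl G.derZero.incl) hs) i hi
      have hr := congrArg (SemiDirectSum.projr G.derZero.incl) hs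
      rw [map_sum, map_zero] at hr
      refine SemiDirectSum.ext hl ?_
      by_cases h0 : i = 0
      · rwa [Finset.sum_eq_single_of_mem i hi
          (fun j hj hji => by exact (hv j hj).2 (h0 ▸ hji))] at hr
      · exact (hv i hi).2 h0
    · rw [eq_top_iff]
      rintro ⟨x, D⟩ -
      have hx : x ∈ ⨆ p, G.g p := G.internal.submodule_iSup_eq_top ▸ Submodule.mem_top
      have hD : (⟨x, D⟩ : G.DerExt) = SemiDirectSum.inl _ x + SemiDirectSum.inr _ D := by simp
      rw [hD]
      clear hD
      refine add_mem ?_ (Submodule.mem_iSup_of_mem 0 ⟨zero_mem _, fun h => absurd rfl h⟩)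
      induction hx using Submodule.iSup_induction' with
      | mem p x hx => exact Submodule.mem_iSup_of_mem p ⟨hx, fun _ => rfl⟩
      | zero => rw [map_zero]; exact zero_mem _
      | add a b _ _ ha hb => rw [map_add]; exact add_mem ha hb
  bracket_mem p q x hx y hy := by
    have h₁ : (x.right : LieDerivation ℂ L L) y.left ∈ G.g (p + q) := by
      by_cases hp : p = 0
      · subst hp
        rw [zero_add]
        exact x.right.2 q _ hy.1
      · rw [hx.2 hp]; exact zero_mem _
    have h₂ : (y.right : LieDerivation ℂ L L) x.left ∈ G.g (p + q) := by
      by_cases hq : q = 0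
      · subst hq
        rw [add_zero]
        exact y.right.2 p _ hx.1
      · rw [hy.2 hq]; exact zero_mem _
    refine ⟨sub_mem (add_mem (G.bracket_mem p q _ hx.1 _ hy.1) h₁) h₂, fun hpq => ?_⟩
    change ⁅x.right, y.right⁆ = 0
    by_cases hp : p = 0
    · rw [hy.2 (by omega), lie_zero]
    · rw [hx.2 hp, zero_lie]
  findim p := by
    have : FiniteDimensional ℂ G.derZero :=
      inferInstanceAs (FiniteDimensional ℂ G.derZero.toSubmodule)
    have : FiniteDimensional ℂ G.DerExt :=
      (SemiDirectSum.toProdl G.derZero.incl).symm.finiteDimensional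
    infer_instance

lemma map_inl_derExt [FiniteDimensional ℂ L] {p : ℤ} (hp : p < 0) :
    (G.g p).map (SemiDirectSum.inl G.derZero.incl).toLinearMap = G.derExt.g p := by
  ext z
  constructor
  · rintro ⟨x, hx, rfl⟩
    exact ⟨hx, fun _ => rfl⟩
  · intro hz
    exact ⟨z.left, hz.1, SemiDirectSum.ext rfl (hz.2 hp.ne).symm⟩

lemma IsFGLA.derExt_transitive [FiniteDimensional ℂ L] (hG : G.IsFGLA) :
    G.derExt.Transitive := by
  intro p hp x hx hkill
  have hl : x.left = 0 := by simpa [hG.nonneg p hp] using hx.1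
  refine SemiDirectSum.ext hl (Subtype.ext (LieDerivation.ext fun a => ?_))
  have hker : LinearMap.ker (x.right : LieDerivation ℂ L L).toLinearMap = ⊤ := by
    rw [eq_top_iff, ← G.internal.submodule_iSup_eq_top, iSup_le_iff]
    intro q y hy
    rcases lt_or_ge q 0 with hq | hq
    · have := congrArg SemiDirectSum.left
        (hkill q hq (SemiDirectSum.inl _ y) ⟨hy, fun _ => rfl⟩)
      simpa [hl] using this
    · rw [hG.nonneg q hq, Submodule.mem_bot] at hy
      rw [hy]
      exact zero_mem _
  have ha : a ∈ LinearMap.ker (x.right : LieDerivation ℂ L L).toLinearMap :=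
    hker ▸ Submodule.mem_top
  exact ha

lemma genGrade_tangent_mem (V : Submodule ℂ (Tangent L))
    (hV : ∀ z ∈ V, z.base ∈ G.g (-1) ∧ z.vec ∈ G.g (-1)) {p : ℤ} {z : Tangent L}
    (hz : z ∈ genGrade V p) : z.base ∈ G.g p ∧ z.vec ∈ G.g p := by
  cases p with
  | ofNat k =>
    rw [(Submodule.mem_bot ℂ).1 hz]
    exact ⟨zero_mem _, zero_mem _⟩
  | negSucc k =>
    change z ∈ genPart V k at hz
    induction k generalizing z with
    | zero => exact hV z hz
    | succ k ih =>
      simp only [genPart] at hz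
      induction hz using Submodule.span_induction with
      | mem z hz =>
        obtain ⟨x, hx, y, hy, rfl⟩ := hz
        have hx := ih hx
        have hy := hV y hy
        exact ⟨G.bracket_mem _ _ _ hx.1 _ hy.1, add_mem (G.bracket_mem _ _ _ hx.1 _ hy.2)
          (G.bracket_mem _ _ _ hx.2 _ hy.1)⟩
      | zero => exact ⟨zero_mem _, zero_mem _⟩
      | add a b _ _ ha hb => exact ⟨add_mem ha.1 hb.1, add_mem ha.2 hb.2⟩
      | smul c a _ ha => exact ⟨Submodule.smul_mem _ c ha.1, Submodule.smul_mem _ c ha.2⟩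

lemma iSupIndep_genGrade_tangent (V : Submodule ℂ (Tangent L))
    (hV : ∀ z ∈ V, z.base ∈ G.g (-1) ∧ z.vec ∈ G.g (-1)) : iSupIndep (genGrade V) := by
  have h := G.internal.submodule_iSupIndep
  rw [iSupIndep_iff_finsetSum_eq_zero_imp_eq_zero] at h ⊢
  intro s v hv hs i hi
  refine Tangent.ext ?_ ?_
  · exact h s (fun i => (v i).base) (fun i hi => (genGrade_tangent_mem V hV (hv i hi)).1)
      (by simpa [map_sum] using congrArg (Tangent.baseHom L) hs) i hi
  · exact h s (fun i => (v i).vec) (fun i hi => (genGrade_tangent_mem V hV (hv i hi)).2)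
      (by simpa [map_sum] using congrArg (Tangent.vecHom L) hs) i hi

lemma IsFGLA.le_map_base_genPart (hG : G.IsFGLA) (V : Submodule ℂ (Tangent L))
    (hV : G.g (-1) ≤ V.map (Tangent.baseHom L).toLinearMap) (k : ℕ) :
    G.g (Int.negSucc k) ≤ (genPart V k).map (Tangent.baseHom L).toLinearMap := by
  induction k with
  | zero => exact hV
  | succ k ih =>
    rw [← show Int.negSucc k - 1 = Int.negSucc (k + 1) from rfl,
      hG.generated _ (Int.negSucc_lt_zero k), Submodule.span_le]
    rintro _ ⟨x, hx, y, hy, rfl⟩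
    obtain ⟨x', hx', rfl⟩ := ih hx
    obtain ⟨y', hy', rfl⟩ := hV hy
    exact ⟨⁅x', y'⁆, Submodule.subset_span ⟨x', hx', y', hy', rfl⟩, rfl⟩

end GLA

open GLA LieAlgebra in
/-- Every endomorphism of `g₋₁` extends to a derivation of degree zero of a free FGLA. -/
lemma IsFreeFGLA.exists_derivation {L : Type} [LieRing L] [LieAlgebra ℂ L] {G : GLA L}
    {n μ : ℕ} (hμ : μ ≠ 0) (hG : IsFreeFGLA G n μ) (T : Module.End ℂ (G.g (-1))) :
    ∃ D : G.derZero, ∀ x : G.g (-1), (D : LieDerivation ℂ L L) x = T x := by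
  obtain ⟨hF, hK, -, huniv⟩ := hG
  have := hF.fd
  let γ : G.g (-1) →ₗ[ℂ] Tangent L :=
    { toFun := fun x => ⟨x, T x⟩
      map_add' := fun x y => by ext <;> simp
      map_smul' := fun c x => by ext <;> simp }
  let V : Submodule ℂ (Tangent L) := LinearMap.range γ
  have hV : ∀ z ∈ V, z.base ∈ G.g (-1) ∧ z.vec ∈ G.g (-1) := by
    rintro _ ⟨x, rfl⟩
    exact ⟨x.2, (T x).2⟩
  have hVbase : G.g (-1) ≤ V.map (Tangent.baseHom L).toLinearMap :=
    fun x hx => ⟨γ ⟨x, hx⟩, ⟨_, rfl⟩, rfl⟩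
  have hind := iSupIndep_genGrade_tangent V hV
  have hVne : V ≠ ⊥ := fun h => hF.neg_one_ne_bot (by
    rw [h, Submodule.map_bot] at hVbase
    exact le_bot_iff.1 hVbase)
  have hkind : (generatedBy V hind).IsOfKind μ := by
    obtain ⟨k, rfl⟩ := Nat.exists_eq_succ_of_ne_zero hμ
    refine ⟨fun hbot => hK.1 ?_, fun p hp => ?_⟩
    · have h₀ : genPart V k = ⊥ := by
        rw [← show genGrade V (-((k.succ : ℕ) : ℤ)) = genPart V k from rfl,
          ← map_comap_genGrade V]
        change ((generatedBy V hind).g _).map _ = ⊥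
        rw [hbot, Submodule.map_bot]
      have := hF.le_map_base_genPart V hVbase k
      rw [h₀, Submodule.map_bot] at this
      exact le_bot_iff.1 this
    · rw [eq_bot_iff]
      intro z hz
      have := genGrade_tangent_mem V hV (p := p) hz
      rw [hK.2 p hp] at this
      exact Subtype.ext (Tangent.ext this.1 this.2)
  let φ : G.g (-1) →ₗ[ℂ] (generatedBy V hind).g (-1) :=
    LinearMap.codRestrict _
      (LinearMap.codRestrict (genSubalgebra V).toSubmodule γ
        fun x => genGrade_le V (Int.negSucc 0) ⟨x, rfl⟩) fun x => ⟨x, rfl⟩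
  have hφ : Function.Surjective φ := by
    rintro ⟨z, x, hx⟩
    exact ⟨x, Subtype.ext (Subtype.ext hx)⟩
  obtain ⟨Φ, ⟨hdeg, -, hext⟩, -⟩ := huniv _ _ (generatedBy_isFGLA V hind hVne) hkind φ hφ
  have hextγ : ∀ x : G.g (-1), (Φ x : Tangent L) = γ x := fun x => by
    rw [hext]; rfl
  have hbase : ∀ x, (Φ x : Tangent L).base = x := by
    let S : Submodule ℂ L := LinearMap.eqLocus
      ((Tangent.baseHom L).comp ((genSubalgebra V).incl.comp Φ)).toLinearMap LinearMap.id
    have hS : S = ⊤ := by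
      have h₁ : G.g (-1) ≤ S := fun x hx => congrArg Tangent.base (hextγ ⟨x, hx⟩)
      refine hF.iSup_le_of_neg_one h₁ fun x hx y hy => ?_
      have hx : (Φ x : Tangent L).base = x := hx
      have hy : (Φ y : Tangent L).base = y := h₁ hy
      change (Φ ⁅x, y⁆ : Tangent L).base = ⁅x, y⁆
      rw [LieHom.map_lie, LieSubalgebra.coe_bracket, Tangent.base_lie, hx, hy]
    intro x
    have hx : x ∈ S := hS ▸ Submodule.mem_top
    exact hx
  let D : LieDerivation ℂ L L :=
    { toLinearMap := Tangent.vecHom L ∘ₗ (genSubalgebra V).toSubmodule.subtype ∘ₗ Φ.toLinearMap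
      leibniz' := fun a b => by
        change (Φ ⁅a, b⁆ : Tangent L).vec
          = ⁅a, (Φ b : Tangent L).vec⁆ - ⁅b, (Φ a : Tangent L).vec⁆
        rw [LieHom.map_lie, LieSubalgebra.coe_bracket, Tangent.vec_lie, hbase, hbase,
          sub_eq_add_neg, lie_skew] }
  refine ⟨⟨D, fun p x hx => (genGrade_tangent_mem V hV (p := p) (hdeg p x hx)).2⟩, fun x => ?_⟩
  exact congrArg Tangent.vec (hextγ x)

open LieAlgebra in
/-- Degree-zero derivations of an FGLA act through degree zero of its prolongation. -/
lemma IsProlongation.exists_of_derivation {Lm LG : Type} [LieRing Lm] [LieAlgebra ℂ Lm]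
    [LieRing LG] [LieAlgebra ℂ LG] {M : GLA Lm} {G : GLA LG} {ι : Lm →ₗ⁅ℂ⁆ LG}
    (hM : M.IsFGLA) (h : IsProlongation M G ι) (D : M.derZero) :
    ∃ X ∈ G.g 0, ∀ y, ⁅X, ι y⁆ = ι ((D : LieDerivation ℂ Lm Lm) y) := by
  have := hM.fd
  obtain ⟨ψ, -, hψ, hcomp⟩ := h.max M.DerExt M.derExt (SemiDirectSum.inl M.derZero.incl)
    (SemiDirectSum.inl_injective _) (fun p hp => GLA.map_inl_derExt hp) hM.derExt_transitive
  refine ⟨ψ (SemiDirectSum.inr _ D), hψ 0 ⟨_, ⟨zero_mem _, fun h => absurd rfl h⟩, rfl⟩,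
    fun y => ?_⟩
  have hι : ∀ z, ι z = ψ (SemiDirectSum.inl _ z) := fun z => by rw [← hcomp]; rfl
  rw [hι, hι, ← LieHom.map_lie]
  congr 1
  simp

/-- A degree-zero element of the prolongation is determined by its action on `g₋₁`. -/
lemma IsProlongation.eq_zero_of_lie_neg_one {Lm LG : Type} [LieRing Lm] [LieAlgebra ℂ Lm]
    [LieRing LG] [LieAlgebra ℂ LG] {M : GLA Lm} {G : GLA LG} {ι : Lm →ₗ⁅ℂ⁆ LG}
    (hM : M.IsFGLA) (h : IsProlongation M G ι) {X : LG} (hX : X ∈ G.g 0)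
    (hkill : ∀ y ∈ G.g (-1), ⁅X, y⁆ = 0) : X = 0 := by
  have hι : ∀ y ∈ M.g (-1), ⁅X, ι y⁆ = 0 := fun y hy =>
    hkill _ (h.graded_neg (-1) (by norm_num) ▸ Submodule.mem_map_of_mem hy)
  have htop : LinearMap.ker ((LieAlgebra.ad ℂ LG X).comp ι.toLinearMap) = ⊤ := by
    refine hM.iSup_le_of_neg_one hι fun x hx y hy => ?_
    have hx : ⁅X, ι x⁆ = 0 := hx
    change ⁅X, ι ⁅x, y⁆⁆ = 0
    rw [LieHom.map_lie, leibniz_lie, hx, hι y hy, zero_lie, lie_zero, add_zero]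
  refine h.trans 0 le_rfl X hX fun q hq y hy => ?_
  rw [← h.graded_neg q hq] at hy
  obtain ⟨z, -, rfl⟩ := hy
  have hz : z ∈ LinearMap.ker ((LieAlgebra.ad ℂ LG X).comp ι.toLinearMap) :=
    htop ▸ Submodule.mem_top
  exact hz

/-- For the prolongation `g(m)` of a free FGLA `m`, the map
`g(m)₀ → gl(g₋₁)`, `X ↦ (ad X)|g₋₁`, is a Lie algebra isomorphism. -/
theorem prolongation_deg_zero_iso_gl {Lm LG : Type} [LieRing Lm] [LieAlgebra ℂ Lm]
    [LieRing LG] [LieAlgebra ℂ LG] (M : GLA Lm) (n μ : ℕ) (hμ : 2 ≤ μ)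
    (hfree : IsFreeFGLA M n μ)
    (G : GLA LG) (ι : Lm →ₗ⁅ℂ⁆ LG) (hprol : IsProlongation M G ι) :
    ∃ Φ : (G.g 0) → Module.End ℂ (G.g (-1)),
      (∀ (X : G.g 0) (Y : G.g (-1)), ((Φ X) Y : LG) = ⁅(X : LG), (Y : LG)⁆) ∧
      Function.Bijective Φ ∧
      (∀ X Y Z : G.g 0, (Z : LG) = ⁅(X : LG), (Y : LG)⁆ → Φ Z = ⁅Φ X, Φ Y⁆) := by
  have hF := hfree.1
  have hmem : ∀ X ∈ G.g 0, ∀ Y ∈ G.g (-1), ⁅X, Y⁆ ∈ G.g (-1) := fun X hX Y hY => by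
    simpa using G.bracket_mem 0 (-1) X hX Y hY
  let Φ : G.g 0 → Module.End ℂ (G.g (-1)) := fun X =>
    (LieAlgebra.ad ℂ LG (X : LG)).restrict (hmem X X.2)
  have hΦ : ∀ (X : G.g 0) (Y : G.g (-1)), ((Φ X) Y : LG) = ⁅(X : LG), (Y : LG)⁆ :=
    fun _ _ => rfl
  refine ⟨Φ, hΦ, ⟨fun X Y hXY => ?_, fun T => ?_⟩, fun X Y Z hZ => ?_⟩
  · refine Subtype.ext (sub_eq_zero.1 ?_)
    refine hprol.eq_zero_of_lie_neg_one hF (sub_mem X.2 Y.2) fun y hy => ?_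
    rw [sub_lie, ← hΦ X ⟨y, hy⟩, ← hΦ Y ⟨y, hy⟩, hXY, sub_self]
  · let e : M.g (-1) ≃ₗ[ℂ] G.g (-1) :=
      (Submodule.equivMapOfInjective ι.toLinearMap hprol.inj (M.g (-1))).trans
        (LinearEquiv.ofEq _ _ (hprol.graded_neg (-1) (by norm_num)))
    have he : ∀ x, (e x : LG) = ι x := fun _ => rfl
    obtain ⟨D, hD⟩ := hfree.exists_derivation (by omega) (e.symm.conj T)
    obtain ⟨X, hX, hXD⟩ := hprol.exists_of_derivation hF D
    refine ⟨⟨X, hX⟩, LinearMap.ext fun y => Subtype.ext ?_⟩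
    obtain ⟨x, rfl⟩ := e.surjective y
    rw [hΦ, he, hXD, hD, ← he]
    simp [LinearEquiv.conj_apply]
  · refine LinearMap.ext fun y => Subtype.ext ?_
    rw [hΦ, hZ, lie_lie]
    rfl
end

section
/- For all positive integers m, n and every integer μ ≥ 2, there exists a free pseudo-product fundamental graded Lie algebra of type (m, n, μ) over ℂ, and any two free pseudo-product fundamental graded Lie algebras of type (m, n, μ) are isomorphic as pseudo-product graded Lie algebras (i.e., via a graded Lie algebra isomorphism carrying e to e' and f to f'). -/
open scoped TensorProduct

/-- A package consisting of a complex graded Lie algebra with a pseudo-product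
structure which is a free pseudo-product FGLA of type `(m, n, μ)`. -/
structure FreePPFGLAPkg (m n μ : ℕ) where
  carrier : Type
  [lieRing : LieRing carrier]
  [lieAlg : LieAlgebra ℂ carrier]
  G : GLA carrier
  e : Submodule ℂ carrier
  f : Submodule ℂ carrier
  free : IsFreePPFGLA G e f m n μ

section Layers

variable {L : Type} [LieRing L] [LieAlgebra ℂ L] {L' : Type} [LieRing L'] [LieAlgebra ℂ L']

/-- The span of the left-normed brackets of length `k` of elements of `V`. -/
def lieLayer (V : Submodule ℂ L) : ℕ → Submodule ℂ L
  | 0 => ⊥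
  | 1 => V
  | k + 2 => Submodule.span ℂ {z : L | ∃ x ∈ lieLayer V (k + 1), ∃ y ∈ V, z = ⁅x, y⁆}

lemma lie_mem_lieLayer_succ {V : Submodule ℂ L} {k : ℕ} {x y : L} (hx : x ∈ lieLayer V k)
    (hy : y ∈ V) : ⁅x, y⁆ ∈ lieLayer V (k + 1) := by
  cases k with
  | zero =>
    rw [lieLayer, Submodule.mem_bot] at hx
    simp [hx]
  | succ k => exact Submodule.subset_span ⟨x, hx, y, hy, rfl⟩

lemma lie_mem_lieLayer_add {V : Submodule ℂ L} (k l : ℕ) {x y : L} (hx : x ∈ lieLayer V k)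
    (hy : y ∈ lieLayer V l) : ⁅x, y⁆ ∈ lieLayer V (k + l) := by
  induction l using Nat.strong_induction_on generalizing k x y with
  | _ l ih =>
    obtain _ | _ | l := l
    · rw [lieLayer, Submodule.mem_bot] at hy
      simp [hy]
    · exact lie_mem_lieLayer_succ hx hy
    · rw [lieLayer] at hy
      induction hy using Submodule.span_induction with
      | mem z hz =>
        obtain ⟨u, hu, v, hv, rfl⟩ := hz
        have h₁ : ⁅⁅x, u⁆, v⁆ ∈ lieLayer V (k + (l + 2)) :=
          lie_mem_lieLayer_succ (ih (l + 1) (by omega) k hx hu) hv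
        have h₂ : ⁅⁅x, v⁆, u⁆ ∈ lieLayer V (k + (l + 2)) := by
          have := ih (l + 1) (by omega) (k + 1) (lie_mem_lieLayer_succ hx hv) hu
          rwa [show k + 1 + (l + 1) = k + (l + 2) by omega] at this
        rw [leibniz_lie, ← lie_skew u ⁅x, v⁆, ← sub_eq_add_neg]
        exact Submodule.sub_mem _ h₁ h₂
      | zero => simp
      | add a b _ _ ha hb => rw [lie_add]; exact Submodule.add_mem _ ha hb
      | smul c a _ ha => rw [lie_smul]; exact Submodule.smul_mem _ c ha

lemma lieLayer_fg {V : Submodule ℂ L} (hV : V.FG) (k : ℕ) : (lieLayer V k).FG := by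
  match k with
  | 0 => exact Submodule.fg_bot
  | 1 => exact hV
  | k + 2 =>
    let B : L →ₗ[ℂ] L →ₗ[ℂ] L := LinearMap.mk₂ ℂ (fun x y => ⁅x, y⁆) add_lie smul_lie lie_add
      (fun c x y => lie_smul c x y)
    have h : lieLayer V (k + 2) = Submodule.map₂ B (lieLayer V (k + 1)) V := by
      rw [Submodule.map₂_eq_span_image2, lieLayer]
      congr 1
      ext z
      simp [Set.mem_image2, B, eq_comm]
    rw [h]
    exact (lieLayer_fg hV (k + 1)).map₂ B hV

lemma map_mem_lieLayer (Φ : L →ₗ⁅ℂ⁆ L') {V : Submodule ℂ L} {V' : Submodule ℂ L'}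
    (h : ∀ v ∈ V, Φ v ∈ V') (k : ℕ) :
    ∀ x ∈ lieLayer V k, Φ x ∈ lieLayer V' k := by
  match k with
  | 0 =>
    intro x hx
    rw [lieLayer, Submodule.mem_bot] at hx
    simp [hx]
  | 1 => exact h
  | k + 2 =>
    intro x hx
    rw [lieLayer] at hx
    induction hx using Submodule.span_induction with
    | mem z hz =>
      obtain ⟨u, hu, v, hv, rfl⟩ := hz
      rw [LieHom.map_lie]
      exact lie_mem_lieLayer_succ (map_mem_lieLayer Φ h (k + 1) u hu) (h v hv)
    | zero => simp
    | add a b _ _ ha hb => rw [map_add]; exact Submodule.add_mem _ ha hb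
    | smul c a _ ha => rw [map_smul]; exact Submodule.smul_mem _ c ha

lemma lieLayer_le_range (Φ : L →ₗ⁅ℂ⁆ L') {V' : Submodule ℂ L'}
    (h : ∀ v ∈ V', v ∈ Φ.range) (k : ℕ) : lieLayer V' k ≤ Φ.range.toSubmodule := by
  match k with
  | 0 => exact bot_le
  | 1 => exact h
  | k + 2 =>
    rw [lieLayer, Submodule.span_le]
    rintro _ ⟨u, hu, v, hv, rfl⟩
    exact Φ.range.lie_mem (lieLayer_le_range Φ h (k + 1) hu) (h v hv)

lemma lieLayer_succ_le_lowerCentralSeries (V : Submodule ℂ L) (k : ℕ) :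
    lieLayer V (k + 1) ≤ (LieModule.lowerCentralSeries ℂ L L k).toSubmodule := by
  induction k with
  | zero => simp
  | succ k ih =>
    rw [lieLayer, Submodule.span_le]
    rintro _ ⟨u, hu, v, -, rfl⟩
    rw [← lie_skew, SetLike.mem_coe, LieSubmodule.mem_toSubmodule, neg_mem_iff,
      LieModule.lowerCentralSeries_succ]
    exact LieSubmodule.lie_mem_lie (LieSubmodule.mem_top v) (ih hu)

lemma iSup_lieLayer_eq_top {V : Submodule ℂ L}
    (h : ∀ S : LieSubalgebra ℂ L, V ≤ S.toSubmodule → S = ⊤) : ⨆ k, lieLayer V k = ⊤ := by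
  let S : LieSubalgebra ℂ L :=
    { (⨆ k, lieLayer V k) with
      lie_mem' := by
        intro x y hx hy
        change x ∈ ⨆ k, lieLayer V k at hx
        change y ∈ ⨆ k, lieLayer V k at hy
        change ⁅x, y⁆ ∈ ⨆ k, lieLayer V k
        induction hx using Submodule.iSup_induction' with
        | mem i x hx =>
          induction hy using Submodule.iSup_induction' with
          | mem j y hy =>
            exact Submodule.mem_iSup_of_mem (i + j) (lie_mem_lieLayer_add i j hx hy)
          | zero => simp
          | add a b _ _ ha hb => rw [lie_add]; exact Submodule.add_mem _ ha hb
        | zero => simp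
        | add a b _ _ ha hb => rw [add_lie]; exact Submodule.add_mem _ ha hb }
  have hS := h S (le_iSup (lieLayer V) 1)
  exact congrArg LieSubalgebra.toSubmodule hS

lemma lowerCentralSeries_le_iSup_lieLayer {V : Submodule ℂ L} (h : ⨆ k, lieLayer V k = ⊤)
    (k : ℕ) : (LieModule.lowerCentralSeries ℂ L L k).toSubmodule ≤
      ⨆ j, lieLayer V (k + 1 + j) := by
  induction k with
  | zero =>
    intro x _
    have hx : x ∈ ⨆ k, lieLayer V k := h ▸ Submodule.mem_top
    induction hx using Submodule.iSup_induction' with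
    | mem i x hx =>
      cases i with
      | zero =>
        rw [lieLayer, Submodule.mem_bot] at hx
        simp [hx]
      | succ i =>
        refine Submodule.mem_iSup_of_mem i ?_
        rwa [show 0 + 1 + i = i + 1 by omega]
    | zero => simp
    | add a b _ _ ha hb => exact Submodule.add_mem _ (ha (by simp)) (hb (by simp))
  | succ k ih =>
    rw [LieModule.lowerCentralSeries_succ, LieSubmodule.lieIdeal_oper_eq_linear_span',
      Submodule.span_le]
    rintro _ ⟨x, -, y, hy, rfl⟩
    have hx : x ∈ ⨆ k, lieLayer V k := h ▸ Submodule.mem_top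
    replace hy := ih hy
    rw [SetLike.mem_coe]
    induction hx using Submodule.iSup_induction' with
    | mem i x hx =>
      induction hy using Submodule.iSup_induction' with
      | mem j y hy =>
        cases i with
        | zero =>
          rw [lieLayer, Submodule.mem_bot] at hx
          simp [hx]
        | succ i =>
          refine Submodule.mem_iSup_of_mem (i + j) ?_
          have := lie_mem_lieLayer_add _ _ hx hy
          rwa [show i + 1 + (k + 1 + j) = k + 1 + 1 + (i + j) by omega] at this
      | zero => simp
      | add a b _ _ ha hb => rw [lie_add]; exact Submodule.add_mem _ ha hb
    | zero => simp
    | add a b _ _ ha hb => rw [add_lie]; exact Submodule.add_mem _ ha hb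

lemma map_lieLayer_eq_smul (σ : L →ₗ⁅ℂ⁆ L) {V : Submodule ℂ L}
    (hσ : ∀ v ∈ V, σ v = (2 : ℂ) • v) (k : ℕ) :
    ∀ x ∈ lieLayer V k, σ x = (2 : ℂ) ^ k • x := by
  match k with
  | 0 =>
    intro x hx
    rw [lieLayer, Submodule.mem_bot] at hx
    simp [hx]
  | 1 => rw [pow_one]; exact hσ
  | k + 2 =>
    intro x hx
    rw [lieLayer] at hx
    induction hx using Submodule.span_induction with
    | mem z hz =>
      obtain ⟨u, hu, v, hv, rfl⟩ := hz
      rw [LieHom.map_lie, map_lieLayer_eq_smul σ hσ (k + 1) u hu, hσ v hv, smul_lie, lie_smul,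
        smul_smul, ← pow_succ]
    | zero => simp
    | add a b _ _ ha hb => rw [map_add, ha, hb, smul_add]
    | smul c a _ ha => rw [map_smul, ha, smul_comm]

/-- A Lie algebra generated by a finite-dimensional subspace `V` and carrying an endomorphism
which doubles every element of `V` is graded by bracket length in elements of `V`. -/
def GLA.ofDoubling (V : Submodule ℂ L) (hV : V.FG) (htop : ⨆ k, lieLayer V k = ⊤)
    (σ : L →ₗ⁅ℂ⁆ L) (hσ : ∀ v ∈ V, σ v = (2 : ℂ) • v) : GLA L where
  g p := lieLayer V (-p).toNat
  internal := by
    refine DirectSum.isInternal_submodule_of_iSupIndep_of_iSup_eq_top ?_ ?_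
    · have hinj : Function.Injective fun p : ℤ => (2 : ℂ) ^ (-p) := by
        intro p q hpq
        have h : ((2 : ℝ) : ℂ) ^ (-p) = ((2 : ℝ) : ℂ) ^ (-q) := by simpa using hpq
        have h' : (2 : ℝ) ^ (-p) = (2 : ℝ) ^ (-q) := by exact_mod_cast h
        simpa using zpow_right_injective₀ (by norm_num) (by norm_num) h'
      refine ((Module.End.eigenspaces_iSupIndep (σ : L →ₗ[ℂ] L)).comp hinj).mono ?_
      intro p x hx
      change x ∈ lieLayer V (-p).toNat at hx
      rcases le_or_gt 0 p with hp | hp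
      · rw [show (-p).toNat = 0 by omega, lieLayer, Submodule.mem_bot] at hx
        simp [hx]
      · rw [Function.comp_apply, Module.End.mem_eigenspace_iff]
        have h := map_lieLayer_eq_smul σ hσ _ x hx
        rw [← zpow_natCast, Int.toNat_of_nonneg (by omega)] at h
        exact h
    · rw [eq_top_iff, ← htop]
      refine iSup_le fun k => ?_
      refine le_trans ?_ (le_iSup _ (-(k : ℤ)))
      simp
  bracket_mem := by
    intro p q x hx y hy
    rcases le_or_gt 0 p with hp | hp
    · rw [show (-p).toNat = 0 by omega, lieLayer, Submodule.mem_bot] at hx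
      simp [hx]
    rcases le_or_gt 0 q with hq | hq
    · rw [show (-q).toNat = 0 by omega, lieLayer, Submodule.mem_bot] at hy
      simp [hy]
    rw [show (-(p + q)).toNat = (-p).toNat + (-q).toNat by omega]
    exact lie_mem_lieLayer_add _ _ hx hy
  findim p := Module.Finite.iff_fg.mpr (lieLayer_fg hV _)

lemma GLA.IsFGLA.g_eq_lieLayer {G : GLA L} (hG : G.IsFGLA) (p : ℤ) :
    G.g p = lieLayer (G.g (-1)) (-p).toNat := by
  have key : ∀ k : ℕ, G.g (-((k : ℤ) + 1)) = lieLayer (G.g (-1)) (k + 1) := by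
    intro k
    induction k with
    | zero => simp [lieLayer]
    | succ k ih =>
      rw [lieLayer, ← ih, ← hG.generated _ (by omega)]
      congr 1
  rcases le_or_gt 0 p with hp | hp
  · rw [show (-p).toNat = 0 by omega, lieLayer, hG.nonneg p hp]
  · obtain ⟨k, hk⟩ : ∃ k : ℕ, p = -((k : ℤ) + 1) := ⟨(-p - 1).toNat, by omega⟩
    rw [hk, key k]
    congr 1

lemma GLA.IsFGLA.iSup_lieLayer {G : GLA L} (hG : G.IsFGLA) :
    ⨆ k, lieLayer (G.g (-1)) k = ⊤ := by
  rw [eq_top_iff, ← G.internal.submodule_iSup_eq_top]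
  refine iSup_le fun p => ?_
  rw [hG.g_eq_lieLayer p]
  exact le_iSup (lieLayer (G.g (-1))) _

lemma GLA.IsFGLA.lowerCentralSeries_eq_bot {G : GLA L} (hG : G.IsFGLA) {μ : ℕ}
    (hμ : G.IsOfKind μ) : LieModule.lowerCentralSeries ℂ L L μ = ⊥ := by
  rw [← LieSubmodule.toSubmodule_eq_bot, eq_bot_iff]
  refine (lowerCentralSeries_le_iSup_lieLayer hG.iSup_lieLayer μ).trans (iSup_le fun j => ?_)
  have h := hG.g_eq_lieLayer (-((μ + 1 + j : ℕ) : ℤ))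
  rw [neg_neg, Int.toNat_natCast] at h
  rw [← h, hμ.2 _ (by omega)]

lemma lie_eq_zero_of_mem_span {s : Set L}
    (h : ∀ x ∈ s, ∀ y ∈ s, ⁅x, y⁆ = 0) {x y : L} (hx : x ∈ Submodule.span ℂ s)
    (hy : y ∈ Submodule.span ℂ s) : ⁅x, y⁆ = 0 := by
  induction hx using Submodule.span_induction with
  | mem x hx =>
    induction hy using Submodule.span_induction with
    | mem y hy => exact h x hx y hy
    | zero => simp
    | add a b _ _ ha hb => rw [lie_add, ha, hb, add_zero]
    | smul c a _ ha => rw [lie_smul, ha, smul_zero]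
  | zero => simp
  | add a b _ _ ha hb => rw [add_lie, ha, hb, add_zero]
  | smul c a _ ha => rw [smul_lie, ha, smul_zero]

end Layers

section FreeNilpotent

/-- The free Lie algebra relations `[xᵢ, xⱼ] = 0`, `[yᵢ, yⱼ] = 0`, together with the vanishing of
all brackets of length greater than `μ`. -/
noncomputable def freePPIdeal (X Y : Type) (μ : ℕ) : LieIdeal ℂ (FreeLieAlgebra ℂ (X ⊕ Y)) :=
  LieSubmodule.lieSpan ℂ (FreeLieAlgebra ℂ (X ⊕ Y))
    ({z | ∃ i j : X, z = ⁅FreeLieAlgebra.of ℂ (Sum.inl i : X ⊕ Y), FreeLieAlgebra.of ℂ (Sum.inl j : X ⊕ Y)⁆} ∪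
     {z | ∃ i j : Y, z = ⁅FreeLieAlgebra.of ℂ (Sum.inr i : X ⊕ Y), FreeLieAlgebra.of ℂ (Sum.inr j : X ⊕ Y)⁆} ∪
     (LieModule.lowerCentralSeries ℂ (FreeLieAlgebra ℂ (X ⊕ Y)) (FreeLieAlgebra ℂ (X ⊕ Y)) μ :
      Set (FreeLieAlgebra ℂ (X ⊕ Y))))

/-- The Lie algebra underlying the free pseudo-product FGLA on `X`, `Y` of the `μ`-th kind. -/
abbrev FreePP (X Y : Type) (μ : ℕ) : Type := FreeLieAlgebra ℂ (X ⊕ Y) ⧸ freePPIdeal X Y μ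

namespace FreePP

variable {X Y : Type} {μ : ℕ}

/-- The projection from the free Lie algebra. -/
noncomputable def mk (X Y : Type) (μ : ℕ) : FreeLieAlgebra ℂ (X ⊕ Y) →ₗ⁅ℂ⁆ FreePP X Y μ :=
  { (freePPIdeal X Y μ).toSubmodule.mkQ with
    map_lie' := fun {_ _} => rfl }

lemma mk_surjective : Function.Surjective (mk X Y μ) :=
  (freePPIdeal X Y μ).toSubmodule.mkQ_surjective

lemma mk_eq_zero {z : FreeLieAlgebra ℂ (X ⊕ Y)} : mk X Y μ z = 0 ↔ z ∈ freePPIdeal X Y μ :=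
  Submodule.Quotient.mk_eq_zero _

/-- The generators. -/
noncomputable def gen (μ : ℕ) (s : X ⊕ Y) : FreePP X Y μ := mk X Y μ (FreeLieAlgebra.of ℂ s)

lemma lie_gen_inl (i j : X) : ⁅gen μ (Sum.inl i : X ⊕ Y), gen μ (Sum.inl j : X ⊕ Y)⁆ = 0 := by
  rw [gen, gen, ← LieHom.map_lie, mk_eq_zero]
  exact LieSubmodule.subset_lieSpan (Or.inl (Or.inl ⟨i, j, rfl⟩))

lemma lie_gen_inr (i j : Y) : ⁅gen μ (Sum.inr i : X ⊕ Y), gen μ (Sum.inr j : X ⊕ Y)⁆ = 0 := by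
  rw [gen, gen, ← LieHom.map_lie, mk_eq_zero]
  exact LieSubmodule.subset_lieSpan (Or.inl (Or.inr ⟨i, j, rfl⟩))

lemma lowerCentralSeries_eq_bot :
    LieModule.lowerCentralSeries ℂ (FreePP X Y μ) (FreePP X Y μ) μ = ⊥ := by
  rw [← LieIdeal.lowerCentralSeries_map_eq μ (mk_surjective (X := X) (Y := Y) (μ := μ)),
    LieIdeal.map_eq_bot_iff]
  intro z hz
  rw [LieHom.mem_ker, mk_eq_zero]
  exact LieSubmodule.subset_lieSpan (Or.inr hz)

section Lift

variable {L : Type} [LieRing L] [LieAlgebra ℂ L]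

lemma hom_ext {Φ Ψ : FreePP X Y μ →ₗ⁅ℂ⁆ L} (h : ∀ s, Φ (gen μ s) = Ψ (gen μ s)) : Φ = Ψ := by
  have h' : Φ.comp (mk X Y μ) = Ψ.comp (mk X Y μ) := FreeLieAlgebra.hom_ext h
  ext z
  obtain ⟨z, rfl⟩ := mk_surjective z
  exact LieHom.congr_fun h' z

lemma exists_lift (f : X ⊕ Y → L) (hX : ∀ i j, ⁅f (Sum.inl i), f (Sum.inl j)⁆ = 0)
    (hY : ∀ i j, ⁅f (Sum.inr i), f (Sum.inr j)⁆ = 0)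
    (hL : LieModule.lowerCentralSeries ℂ L L μ = ⊥) :
    ∃ Φ : FreePP X Y μ →ₗ⁅ℂ⁆ L, ∀ s, Φ (gen μ s) = f s := by
  have hker : freePPIdeal X Y μ ≤ (FreeLieAlgebra.lift ℂ f).ker := by
    rw [freePPIdeal, LieSubmodule.lieSpan_le]
    rintro z ((⟨i, j, rfl⟩ | ⟨i, j, rfl⟩) | hz)
    · simp [hX]
    · simp [hY]
    · have h : LieIdeal.map (FreeLieAlgebra.lift ℂ f) (LieModule.lowerCentralSeries ℂ
          (FreeLieAlgebra ℂ (X ⊕ Y)) (FreeLieAlgebra ℂ (X ⊕ Y)) μ) ≤ ⊥ :=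
        (LieIdeal.map_lowerCentralSeries_le μ).trans hL.le
      exact LieIdeal.map_eq_bot_iff.mp (le_bot_iff.mp h) hz
  refine ⟨{ (freePPIdeal X Y μ).toSubmodule.liftQ
              (FreeLieAlgebra.lift ℂ f : FreeLieAlgebra ℂ (X ⊕ Y) →ₗ[ℂ] L)
              (fun z hz => hker hz) with
            map_lie' := ?_ }, fun s => FreeLieAlgebra.lift_of_apply f s⟩
  intro a b
  obtain ⟨a, rfl⟩ := mk_surjective a
  obtain ⟨b, rfl⟩ := mk_surjective b
  exact LieHom.map_lie (FreeLieAlgebra.lift ℂ f) a b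

end Lift

lemma eq_top_of_gen_mem (S : LieSubalgebra ℂ (FreePP X Y μ)) (h : ∀ s, gen μ s ∈ S) :
    S = ⊤ := by
  let F : FreeLieAlgebra ℂ (X ⊕ Y) →ₗ⁅ℂ⁆ S := FreeLieAlgebra.lift ℂ fun s => ⟨gen μ s, h s⟩
  have hF : S.incl.comp F = mk X Y μ := FreeLieAlgebra.hom_ext fun s => by
    simp [F, gen]
  rw [eq_top_iff]
  intro z _
  obtain ⟨z, rfl⟩ := mk_surjective z
  rw [← hF]
  exact (F z).2

lemma exists_doubling (X Y : Type) (μ : ℕ) :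
    ∃ σ : FreePP X Y μ →ₗ⁅ℂ⁆ FreePP X Y μ, ∀ s, σ (gen μ s) = (2 : ℂ) • gen μ s :=
  exists_lift _ (fun i j => by simp [lie_gen_inl]) (fun i j => by simp [lie_gen_inr])
    lowerCentralSeries_eq_bot

attribute [local instance] LieRing.ofAssociativeRing in
lemma linearIndependent_gen (hμ : 1 ≤ μ) : LinearIndependent ℂ (gen (X := X) (Y := Y) μ) := by
  classical
  have hab : ∀ a b : X ⊕ Y → ℂ, ⁅a, b⁆ = 0 := fun a b => by
    rw [LieRing.of_associative_ring_bracket, mul_comm, sub_self]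
  have : IsLieAbelian (X ⊕ Y → ℂ) := ⟨hab⟩
  have hL : LieModule.lowerCentralSeries ℂ (X ⊕ Y → ℂ) (X ⊕ Y → ℂ) μ = ⊥ := by
    rw [← le_bot_iff, ← (LieModule.trivial_iff_lower_central_eq_bot ℂ _ _).mp this]
    exact LieModule.antitone_lowerCentralSeries ℂ _ _ hμ
  obtain ⟨Φ, hΦ⟩ := exists_lift (μ := μ) (fun s : X ⊕ Y => (Pi.single s 1 : X ⊕ Y → ℂ))
    (fun i j => hab _ _) (fun i j => hab _ _) hL
  refine LinearIndependent.of_comp (Φ : _ →ₗ[ℂ] (X ⊕ Y → ℂ)) ?_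
  have : (Φ : FreePP X Y μ →ₗ[ℂ] (X ⊕ Y → ℂ)) ∘ gen μ = fun s => Pi.single s 1 := funext hΦ
  rw [this]
  exact Pi.linearIndependent_single_one (X ⊕ Y) ℂ

end FreePP

end FreeNilpotent

section Filiform

/-- The semidirect product of the line `ℂ` with `R`, the generator of the line acting on `R`
as multiplication by `t`. -/
def ShiftLie {R : Type} (_t : R) : Type := ℂ × R

namespace ShiftLie

variable {R : Type} {t : R}

@[ext] lemma ext {u v : ShiftLie t} (h₁ : u.1 = v.1) (h₂ : u.2 = v.2) : u = v := Prod.ext h₁ h₂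

variable [CommRing R]

instance : AddCommGroup (ShiftLie t) := inferInstanceAs (AddCommGroup (ℂ × R))

@[simp] lemma add_fst (u v : ShiftLie t) : (u + v).1 = u.1 + v.1 := rfl

@[simp] lemma add_snd (u v : ShiftLie t) : (u + v).2 = u.2 + v.2 := rfl

@[simp] lemma zero_fst : (0 : ShiftLie t).1 = 0 := rfl

@[simp] lemma zero_snd : (0 : ShiftLie t).2 = 0 := rfl

variable [Algebra ℂ R]

noncomputable instance : Module ℂ (ShiftLie t) := inferInstanceAs (Module ℂ (ℂ × R))

noncomputable instance : Bracket (ShiftLie t) (ShiftLie t) :=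
  ⟨fun u v => ((0 : ℂ), t * (u.1 • v.2 - v.1 • u.2))⟩

@[simp] lemma lie_fst (u v : ShiftLie t) : ⁅u, v⁆.1 = 0 := rfl

@[simp] lemma lie_snd (u v : ShiftLie t) : ⁅u, v⁆.2 = t * (u.1 • v.2 - v.1 • u.2) := rfl

@[simp] lemma smul_fst (c : ℂ) (u : ShiftLie t) : (c • u).1 = c * u.1 := rfl

@[simp] lemma smul_snd (c : ℂ) (u : ShiftLie t) : (c • u).2 = c • u.2 := rfl

noncomputable instance : LieRing (ShiftLie t) where
  add_lie u v w := by
    ext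
    · simp
    · simp only [lie_snd, add_snd, add_fst, Algebra.smul_def, map_add]; ring
  lie_add u v w := by
    ext
    · simp
    · simp only [lie_snd, add_snd, add_fst, Algebra.smul_def, map_add]; ring
  lie_self u := by
    ext <;> simp
  leibniz_lie u v w := by
    ext
    · simp
    · simp only [lie_snd, lie_fst, add_snd, Algebra.smul_def, map_zero]; ring

noncomputable instance : LieAlgebra ℂ (ShiftLie t) where
  lie_smul c u v := by
    ext
    · simp
    · simp only [lie_snd, smul_snd, smul_fst, Algebra.smul_def, map_mul]; ring

lemma mem_lowerCentralSeries_succ (k : ℕ) :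
    ∀ u ∈ LieModule.lowerCentralSeries ℂ (ShiftLie t) (ShiftLie t) (k + 1),
      u.1 = 0 ∧ t ^ (k + 1) ∣ u.2 := by
  induction k with
  | zero =>
    intro u hu
    rw [LieModule.lowerCentralSeries_succ, ← LieSubmodule.mem_toSubmodule,
      LieSubmodule.lieIdeal_oper_eq_linear_span'] at hu
    induction hu using Submodule.span_induction with
    | mem z hz =>
      obtain ⟨x, -, y, -, rfl⟩ := hz
      exact ⟨rfl, by simp⟩
    | zero => simp
    | add a b _ _ ha hb =>
      exact ⟨by simp [ha.1, hb.1], by rw [add_snd]; exact dvd_add ha.2 hb.2⟩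
    | smul c a _ ha => exact ⟨by simp [ha.1], by rw [smul_snd]; exact ha.2.trans (Algebra.smul_def c a.2 ▸ dvd_mul_left _ _)⟩
  | succ k ih =>
    intro u hu
    rw [LieModule.lowerCentralSeries_succ, ← LieSubmodule.mem_toSubmodule,
      LieSubmodule.lieIdeal_oper_eq_linear_span'] at hu
    induction hu using Submodule.span_induction with
    | mem z hz =>
      obtain ⟨x, -, y, hy, rfl⟩ := hz
      obtain ⟨h₁, h₂⟩ := ih y hy
      refine ⟨rfl, ?_⟩
      rw [lie_snd, h₁, zero_smul, sub_zero, pow_succ']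
      exact mul_dvd_mul_left t (h₂.trans (Algebra.smul_def x.1 y.2 ▸ dvd_mul_left _ _))
    | zero => simp
    | add a b _ _ ha hb =>
      exact ⟨by simp [ha.1, hb.1], by rw [add_snd]; exact dvd_add ha.2 hb.2⟩
    | smul c a _ ha => exact ⟨by simp [ha.1], by rw [smul_snd]; exact ha.2.trans (Algebra.smul_def c a.2 ▸ dvd_mul_left _ _)⟩

lemma lowerCentralSeries_eq_bot {k : ℕ} (ht : t ^ (k + 1) = 0) :
    LieModule.lowerCentralSeries ℂ (ShiftLie t) (ShiftLie t) (k + 1) = ⊥ := by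
  rw [LieSubmodule.eq_bot_iff]
  intro u hu
  obtain ⟨h₁, h₂⟩ := mem_lowerCentralSeries_succ k u hu
  rw [ht, zero_dvd_iff] at h₂
  exact ext h₁ h₂

end ShiftLie

end Filiform

namespace FreePP

variable {X Y : Type} {μ : ℕ}

lemma lieLayer_ne_bot (x₀ : X) (y₀ : Y) (k : ℕ) {V : Submodule ℂ (FreePP X Y (k + 1))}
    (hV : ∀ s, gen (k + 1) s ∈ V) : lieLayer V (k + 1) ≠ ⊥ := by
  classical
  let R := AdjoinRoot (Polynomial.X ^ (k + 1) : Polynomial ℂ)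
  let t : R := AdjoinRoot.root _
  have ht : t ^ (k + 1) = 0 := by
    have h := AdjoinRoot.mk_self (f := (Polynomial.X ^ (k + 1) : Polynomial ℂ))
    rwa [map_pow, AdjoinRoot.mk_X] at h
  have ht' : t ^ k ≠ 0 := by
    intro h
    have h' : AdjoinRoot.mk (Polynomial.X ^ (k + 1) : Polynomial ℂ) (Polynomial.X ^ k) = 0 := by
      simpa [t] using h
    rw [AdjoinRoot.mk_eq_zero, Polynomial.X_pow_dvd_iff] at h'
    simpa using h' k (Nat.lt_succ_self k)
  let a : ShiftLie t := ((1 : ℂ), (0 : R))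
  let b : ShiftLie t := ((0 : ℂ), (1 : R))
  let F : X ⊕ Y → ShiftLie t :=
    Sum.elim (fun i => if i = x₀ then a else 0) (fun i => if i = y₀ then b else 0)
  obtain ⟨Φ, hΦ⟩ := exists_lift (μ := k + 1) F
    (fun i j => by by_cases hi : i = x₀ <;> by_cases hj : j = x₀ <;> simp [F, hi, hj])
    (fun i j => by by_cases hi : i = y₀ <;> by_cases hj : j = y₀ <;> simp [F, hi, hj])
    (ShiftLie.lowerCentralSeries_eq_bot ht)
  have key : ∀ l : ℕ, ∃ z ∈ lieLayer V (l + 1),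
      (Φ z).1 = 0 ∧ (Φ z).2 = (-t) ^ l := by
    intro l
    induction l with
    | zero =>
      refine ⟨gen (k + 1) (Sum.inr y₀), hV _, ?_, ?_⟩ <;> simp [hΦ, F, b]
    | succ l ih =>
      obtain ⟨z, hz, h₁, h₂⟩ := ih
      refine ⟨⁅z, gen (k + 1) (Sum.inl x₀)⁆, lie_mem_lieLayer_succ hz (hV _), ?_, ?_⟩
      · simp
      · have ha : Φ (gen (k + 1) (Sum.inl x₀)) = a := by simp [hΦ, F]
        rw [LieHom.map_lie, ha, ShiftLie.lie_snd, h₁, h₂]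
        simp only [a, zero_smul, one_smul, zero_sub, pow_succ']
        ring
  intro h
  obtain ⟨z, hz, -, h₂⟩ := key k
  rw [h, Submodule.mem_bot] at hz
  rw [hz, map_zero, ShiftLie.zero_snd] at h₂
  refine ht' ?_
  rw [← neg_neg t, neg_pow, ← h₂, mul_zero]

variable (X Y μ) in
/-- The span of all generators. -/
noncomputable def genSpan : Submodule ℂ (FreePP X Y μ) := Submodule.span ℂ (Set.range (gen μ))

lemma gen_mem_genSpan (s : X ⊕ Y) : gen μ s ∈ genSpan X Y μ :=
  Submodule.subset_span ⟨s, rfl⟩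

lemma iSup_lieLayer_genSpan : ⨆ k, lieLayer (genSpan X Y μ) k = ⊤ :=
  iSup_lieLayer_eq_top fun S hS => eq_top_of_gen_mem S fun s => hS (gen_mem_genSpan s)

lemma lieLayer_genSpan_eq_bot {k : ℕ} (hk : μ < k) : lieLayer (genSpan X Y μ) k = ⊥ := by
  obtain ⟨k, rfl⟩ : ∃ l, k = l + 1 := ⟨k - 1, by omega⟩
  rw [eq_bot_iff]
  refine (lieLayer_succ_le_lowerCentralSeries _ k).trans ?_
  refine le_trans (b := (LieModule.lowerCentralSeries ℂ (FreePP X Y μ) (FreePP X Y μ)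
    μ).toSubmodule) (LieModule.antitone_lowerCentralSeries ℂ _ _ (by omega)) ?_
  rw [lowerCentralSeries_eq_bot, LieSubmodule.bot_toSubmodule]

variable (X Y μ) in
/-- The span of the generators `xᵢ`. -/
noncomputable def inlSpan : Submodule ℂ (FreePP X Y μ) :=
  Submodule.span ℂ (Set.range fun i : X => gen μ (Sum.inl i))

variable (X Y μ) in
/-- The span of the generators `yⱼ`. -/
noncomputable def inrSpan : Submodule ℂ (FreePP X Y μ) :=
  Submodule.span ℂ (Set.range fun i : Y => gen μ (Sum.inr i))

lemma gen_inl_mem (i : X) : gen μ (Sum.inl i) ∈ inlSpan X Y μ := Submodule.subset_span ⟨i, rfl⟩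

lemma gen_inr_mem (i : Y) : gen μ (Sum.inr i) ∈ inrSpan X Y μ := Submodule.subset_span ⟨i, rfl⟩

lemma inlSpan_sup_inrSpan : inlSpan X Y μ ⊔ inrSpan X Y μ = genSpan X Y μ := by
  rw [inlSpan, inrSpan, ← Submodule.span_union, genSpan, ← Set.Sum.elim_range]
  congr 2
  ext s
  cases s <;> rfl

variable (X Y μ) in
/-- The grading of the free pseudo-product FGLA by bracket length. -/
noncomputable def gla [Finite X] [Finite Y] : GLA (FreePP X Y μ) :=
  GLA.ofDoubling (genSpan X Y μ) (Submodule.fg_span (Set.finite_range _)) iSup_lieLayer_genSpan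
    (exists_doubling X Y μ).choose (by
      intro v hv
      rw [genSpan] at hv
      induction hv using Submodule.span_induction with
      | mem z hz =>
        obtain ⟨s, rfl⟩ := hz
        exact (exists_doubling X Y μ).choose_spec s
      | zero => simp
      | add a b _ _ ha hb => rw [map_add, ha, hb, smul_add]
      | smul c a _ ha => rw [map_smul, ha, smul_comm])

section Gla

variable [Finite X] [Finite Y]

lemma gla_g (p : ℤ) : (gla X Y μ).g p = lieLayer (genSpan X Y μ) (-p).toNat := rfl

lemma gla_g_neg_one : (gla X Y μ).g (-1) = genSpan X Y μ := rfl

lemma finite : FiniteDimensional ℂ (FreePP X Y μ) := by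
  have h : (⨆ k : Fin (μ + 1), lieLayer (genSpan X Y μ) k) = ⊤ := by
    rw [eq_top_iff, ← iSup_lieLayer_genSpan]
    refine iSup_le fun k => ?_
    rcases lt_or_ge μ k with hk | hk
    · rw [lieLayer_genSpan_eq_bot hk]
      exact bot_le
    · exact le_iSup (fun k : Fin (μ + 1) => lieLayer (genSpan X Y μ) k)
        ⟨k, Nat.lt_succ_of_le hk⟩
  refine Module.finite_def.mpr ?_
  rw [← h]
  exact Submodule.fg_iSup _ fun k => lieLayer_fg (Submodule.fg_span (Set.finite_range _)) k

lemma isOfKind [Nonempty X] [Nonempty Y] (hμ : 1 ≤ μ) : (gla X Y μ).IsOfKind μ := by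
  obtain ⟨k, rfl⟩ : ∃ l, μ = l + 1 := ⟨μ - 1, by omega⟩
  refine ⟨?_, fun p hp => ?_⟩
  · rw [gla_g, neg_neg, Int.toNat_natCast]
    exact lieLayer_ne_bot (Classical.arbitrary X) (Classical.arbitrary Y) k gen_mem_genSpan
  · rw [gla_g]
    exact lieLayer_genSpan_eq_bot (by omega)

lemma isPPFGLA [Nonempty X] [Nonempty Y] (hμ : 1 ≤ μ) :
    IsPPFGLA (gla X Y μ) (inlSpan X Y μ) (inrSpan X Y μ) where
  fgla :=
    { fd := finite
      nonneg := fun p hp => by rw [gla_g, show (-p).toNat = 0 by omega, lieLayer]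
      neg_one_ne_bot := fun h => by
        have hmem := gen_mem_genSpan (Y := Y) (μ := μ) (Sum.inl (Classical.arbitrary X))
        rw [← gla_g_neg_one, h, Submodule.mem_bot] at hmem
        exact (linearIndependent_gen hμ).ne_zero _ hmem
      generated := fun p hp => by
        obtain ⟨k, rfl⟩ : ∃ k : ℕ, p = -((k : ℤ) + 1) := ⟨(-p - 1).toNat, by omega⟩
        rw [gla_g_neg_one, gla_g, gla_g, show (-(-((k : ℤ) + 1) - 1)).toNat = k + 2 by omega,
          show (-(-((k : ℤ) + 1))).toNat = k + 1 by omega, lieLayer] }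
  e_ne_bot := fun h => by
    have hmem := gen_inl_mem (Y := Y) (μ := μ) (Classical.arbitrary X)
    rw [h, Submodule.mem_bot] at hmem
    exact (linearIndependent_gen hμ).ne_zero _ hmem
  f_ne_bot := fun h => by
    have hmem := gen_inr_mem (X := X) (μ := μ) (Classical.arbitrary Y)
    rw [h, Submodule.mem_bot] at hmem
    exact (linearIndependent_gen hμ).ne_zero _ hmem
  sup_eq := inlSpan_sup_inrSpan
  inf_eq := (linearIndependent_sum.mp (linearIndependent_gen hμ)).2.2.eq_bot
  lie_ee := fun x hx y hy => lie_eq_zero_of_mem_span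
    (by rintro _ ⟨i, rfl⟩ _ ⟨j, rfl⟩; exact lie_gen_inl i j) hx hy
  lie_ff := fun x hx y hy => lie_eq_zero_of_mem_span
    (by rintro _ ⟨i, rfl⟩ _ ⟨j, rfl⟩; exact lie_gen_inr i j) hx hy

lemma existsUnique_extension {L : Type} [LieRing L] [LieAlgebra ℂ L] {G : GLA L}
    {e f : Submodule ℂ L} (hG : IsPPFGLA G e f) (hk : G.IsOfKind μ)
    (φ : (gla X Y μ).g (-1) →ₗ[ℂ] G.g (-1)) (hφ : Function.Surjective φ)
    (he : ∀ x, ∀ hx : x ∈ (gla X Y μ).g (-1), x ∈ inlSpan X Y μ → (φ ⟨x, hx⟩ : L) ∈ e)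
    (hf : ∀ x, ∀ hx : x ∈ (gla X Y μ).g (-1), x ∈ inrSpan X Y μ → (φ ⟨x, hx⟩ : L) ∈ f) :
    ∃! Φ : FreePP X Y μ →ₗ⁅ℂ⁆ L,
      (∀ p : ℤ, ∀ x ∈ (gla X Y μ).g p, Φ x ∈ G.g p) ∧ Function.Surjective Φ ∧
      ∀ x : (gla X Y μ).g (-1), Φ (x : FreePP X Y μ) = (φ x : L) := by
  obtain ⟨Φ, hΦ⟩ := exists_lift (μ := μ) (fun s => (φ ⟨gen μ s, gen_mem_genSpan s⟩ : L))
    (fun i j => hG.lie_ee _ (he _ _ (gen_inl_mem i)) _ (he _ _ (gen_inl_mem j)))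
    (fun i j => hG.lie_ff _ (hf _ _ (gen_inr_mem i)) _ (hf _ _ (gen_inr_mem j)))
    (hG.fgla.lowerCentralSeries_eq_bot hk)
  have hext : ∀ x : (gla X Y μ).g (-1), Φ (x : FreePP X Y μ) = (φ x : L) := by
    rintro ⟨x, hx⟩
    have hx' : x ∈ Submodule.span ℂ (Set.range (gen (X := X) (Y := Y) μ)) := hx
    induction hx' using Submodule.span_induction with
    | mem z hz =>
      obtain ⟨s, rfl⟩ := hz
      exact hΦ s
    | zero =>
      have : φ ⟨0, hx⟩ = 0 := map_zero φ
      simp [this]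
    | add a b ha hb iha ihb =>
      have : φ ⟨a + b, hx⟩ = φ ⟨a, ha⟩ + φ ⟨b, hb⟩ := map_add φ ⟨a, ha⟩ ⟨b, hb⟩
      rw [this, Submodule.coe_add, ← iha ha, ← ihb hb, map_add]
    | smul c a ha iha =>
      have : φ ⟨c • a, hx⟩ = c • φ ⟨a, ha⟩ := map_smul φ c ⟨a, ha⟩
      rw [this, Submodule.coe_smul, ← iha ha, map_smul]
  have hV : ∀ v ∈ genSpan X Y μ, Φ v ∈ G.g (-1) := fun v hv => by
    have := hext ⟨v, hv⟩
    rw [this]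
    exact (φ ⟨v, hv⟩).2
  refine ⟨Φ, ⟨fun p x hx => ?_, ?_, hext⟩, fun Ψ hΨ => hom_ext fun s => ?_⟩
  · rw [hG.fgla.g_eq_lieLayer]
    exact map_mem_lieLayer Φ hV _ x hx
  · have hrange : Φ.range.toSubmodule = ⊤ := by
      rw [eq_top_iff, ← hG.fgla.iSup_lieLayer]
      refine iSup_le fun k => lieLayer_le_range Φ (fun v hv => ?_) k
      obtain ⟨u, hu⟩ := hφ ⟨v, hv⟩
      exact ⟨u, by rw [LieHom.coe_toLinearMap, hext u, hu]⟩
    intro y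
    have hy : y ∈ Φ.range.toSubmodule := hrange ▸ Submodule.mem_top
    exact hy
  · rw [hΦ s]
    exact hΨ.2.2 ⟨gen μ s, gen_mem_genSpan s⟩

end Gla

lemma isFreePPFGLA {m n : ℕ} (hm : 1 ≤ m) (hn : 1 ≤ n) (hμ : 1 ≤ μ) :
    IsFreePPFGLA (gla (Fin m) (Fin n) μ) (inlSpan _ _ μ) (inrSpan _ _ μ) m n μ := by
  have : Nonempty (Fin m) := ⟨⟨0, hm⟩⟩
  have : Nonempty (Fin n) := ⟨⟨0, hn⟩⟩
  have hli := linearIndependent_sum.mp (linearIndependent_gen (X := Fin m) (Y := Fin n) hμ)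
  refine ⟨isPPFGLA hμ, isOfKind hμ, ?_, ?_, ?_⟩
  · exact (finrank_span_eq_card hli.1).trans (Fintype.card_fin m)
  · exact (finrank_span_eq_card hli.2.1).trans (Fintype.card_fin n)
  · intro L _ _ G e f hG hk φ hφ he hf
    exact existsUnique_extension hG hk φ hφ he hf

end FreePP

section Uniqueness

variable {L : Type} [LieRing L] [LieAlgebra ℂ L] {L' : Type} [LieRing L'] [LieAlgebra ℂ L']

lemma IsPPFGLA.exists_prod_equiv {G : GLA L} {e f : Submodule ℂ L} (h : IsPPFGLA G e f) :
    ∃ Θ : (e × f) ≃ₗ[ℂ] G.g (-1), ∀ u, (Θ u : L) = u.1 + u.2 := by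
  have hinj : Function.Injective (e.subtype.coprod f.subtype) := by
    rw [← LinearMap.ker_eq_bot, LinearMap.ker_coprod_of_disjoint_range]
    · simp
    · simpa [disjoint_iff] using h.inf_eq
  have hrange : LinearMap.range (e.subtype.coprod f.subtype) = G.g (-1) := by
    rw [LinearMap.range_coprod, Submodule.range_subtype, Submodule.range_subtype, h.sup_eq]
  exact ⟨(LinearEquiv.ofInjective _ hinj).trans (LinearEquiv.ofEq _ _ hrange), fun u => by simp⟩

lemma IsFreePPFGLA.exists_hom {G : GLA L} {e f : Submodule ℂ L} {G' : GLA L'}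
    {e' f' : Submodule ℂ L'} {m n μ : ℕ} (h : IsFreePPFGLA G e f m n μ)
    (h' : IsPPFGLA G' e' f') (hk : G'.IsOfKind μ) (α : e ≃ₗ[ℂ] e') (β : f ≃ₗ[ℂ] f') :
    ∃ Φ : L →ₗ⁅ℂ⁆ L', (∀ p : ℤ, ∀ x ∈ G.g p, Φ x ∈ G'.g p) ∧
      (∀ x : e, Φ x = α x) ∧ ∀ x : f, Φ x = β x := by
  obtain ⟨Θ, hΘ⟩ := h.1.exists_prod_equiv
  obtain ⟨Θ', hΘ'⟩ := h'.exists_prod_equiv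
  let φ := (Θ.symm.trans (α.prodCongr β)).trans Θ'
  have hφ : ∀ u : e × f, (φ (Θ u) : L') = α u.1 + β u.2 := fun u => by simp [φ, hΘ']
  have he : ∀ x : e, ∀ hx : (x : L) ∈ G.g (-1), (φ ⟨x, hx⟩ : L') = α x := fun x hx => by
    have hx' : (⟨x, hx⟩ : G.g (-1)) = Θ (x, 0) := Subtype.ext (by simp [hΘ])
    rw [hx', hφ]
    simp
  have hf : ∀ x : f, ∀ hx : (x : L) ∈ G.g (-1), (φ ⟨x, hx⟩ : L') = β x := fun x hx => by
    have hx' : (⟨x, hx⟩ : G.g (-1)) = Θ (0, x) := Subtype.ext (by simp [hΘ])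
    rw [hx', hφ]
    simp
  obtain ⟨Φ, ⟨hgr, -, hΦ⟩, -⟩ := h.2.2.2.2 L' G' e' f' h' hk φ φ.surjective
    (fun x hx hxe => by have := he ⟨x, hxe⟩ hx; exact this ▸ (α ⟨x, hxe⟩).2)
    (fun x hx hxf => by have := hf ⟨x, hxf⟩ hx; exact this ▸ (β ⟨x, hxf⟩).2)
  have hle : e ≤ G.g (-1) := h.1.sup_eq ▸ le_sup_left
  have hlf : f ≤ G.g (-1) := h.1.sup_eq ▸ le_sup_right
  exact ⟨Φ, hgr, fun x => (hΦ ⟨x, hle x.2⟩).trans (he x _),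
    fun x => (hΦ ⟨x, hlf x.2⟩).trans (hf x _)⟩

lemma IsPPFGLA.hom_eq_id {G : GLA L} {e f : Submodule ℂ L} (h : IsPPFGLA G e f)
    (Φ : L →ₗ⁅ℂ⁆ L) (he : ∀ x ∈ e, Φ x = x) (hf : ∀ x ∈ f, Φ x = x) (x : L) : Φ x = x := by
  have hfix : ∀ x ∈ G.g (-1), Φ x = x := by
    intro x hx
    rw [← h.sup_eq] at hx
    obtain ⟨a, ha, b, hb, rfl⟩ := Submodule.mem_sup.mp hx
    rw [map_add, he a ha, hf b hb]
  have hlayer : ∀ k, lieLayer (G.g (-1)) k ≤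
      LinearMap.eqLocus Φ.toLinearMap LinearMap.id := by
    intro k
    induction k with
    | zero => exact bot_le
    | succ k ih =>
      cases k with
      | zero => exact hfix
      | succ k =>
        rw [lieLayer, Submodule.span_le]
        rintro _ ⟨u, hu, v, hv, rfl⟩
        have hu' : Φ u = u := ih hu
        change Φ ⁅u, v⁆ = ⁅u, v⁆
        rw [LieHom.map_lie, hu', hfix v hv]
  have hx : x ∈ ⨆ k, lieLayer (G.g (-1)) k := h.fgla.iSup_lieLayer ▸ Submodule.mem_top
  exact iSup_le hlayer hx

lemma IsFreePPFGLA.exists_equiv {G : GLA L} {e f : Submodule ℂ L} {G' : GLA L'}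
    {e' f' : Submodule ℂ L'} {m n μ : ℕ}
    (h : IsFreePPFGLA G e f m n μ) (h' : IsFreePPFGLA G' e' f' m n μ) :
    ∃ E : L ≃ₗ⁅ℂ⁆ L',
      (∀ p : ℤ, (G.g p).map (E : L →ₗ⁅ℂ⁆ L').toLinearMap = G'.g p) ∧
      e.map (E : L →ₗ⁅ℂ⁆ L').toLinearMap = e' ∧
      f.map (E : L →ₗ⁅ℂ⁆ L').toLinearMap = f' := by
  have := h.1.fgla.fd
  have := h'.1.fgla.fd
  let α : e ≃ₗ[ℂ] e' := LinearEquiv.ofFinrankEq _ _ (h.2.2.1.trans h'.2.2.1.symm)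
  let β : f ≃ₗ[ℂ] f' := LinearEquiv.ofFinrankEq _ _ (h.2.2.2.1.trans h'.2.2.2.1.symm)
  obtain ⟨Φ, hΦ, hΦe, hΦf⟩ := h.exists_hom h'.1 h'.2.1 α β
  obtain ⟨Ψ, hΨ, hΨe, hΨf⟩ := h'.exists_hom h.1 h.2.1 α.symm β.symm
  have hid : ∀ x, Ψ (Φ x) = x := h.1.hom_eq_id (Ψ.comp Φ)
    (fun x hx => by simpa [hΦe ⟨x, hx⟩] using hΨe (α ⟨x, hx⟩))
    (fun x hx => by simpa [hΦf ⟨x, hx⟩] using hΨf (β ⟨x, hx⟩))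
  have hid' : ∀ x, Φ (Ψ x) = x := h'.1.hom_eq_id (Φ.comp Ψ)
    (fun x hx => by simpa [hΨe ⟨x, hx⟩] using hΦe (α.symm ⟨x, hx⟩))
    (fun x hx => by simpa [hΨf ⟨x, hx⟩] using hΦf (β.symm ⟨x, hx⟩))
  have hmap : ∀ (A : Submodule ℂ L) (B : Submodule ℂ L'), (∀ x ∈ A, Φ x ∈ B) →
      (∀ y ∈ B, Ψ y ∈ A) → A.map Φ.toLinearMap = B := by
    intro A B hAB hBA
    refine le_antisymm (Submodule.map_le_iff_le_comap.mpr hAB) fun y hy => ?_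
    exact ⟨Ψ y, hBA y hy, hid' y⟩
  refine ⟨{ Φ with invFun := Ψ, left_inv := hid, right_inv := hid' },
    fun p => hmap _ _ (hΦ p) (hΨ p), hmap _ _ ?_ ?_, hmap _ _ ?_ ?_⟩
  · exact fun x hx => (hΦe ⟨x, hx⟩).symm ▸ (α ⟨x, hx⟩).2
  · exact fun x hx => (hΨe ⟨x, hx⟩).symm ▸ (α.symm ⟨x, hx⟩).2
  · exact fun x hx => (hΦf ⟨x, hx⟩).symm ▸ (β ⟨x, hx⟩).2
  · exact fun x hx => (hΨf ⟨x, hx⟩).symm ▸ (β.symm ⟨x, hx⟩).2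

end Uniqueness

/-- For all `m, n ≥ 1` and `μ ≥ 2` there exists a free pseudo-product FGLA of type
`(m, n, μ)` over `ℂ`, and any two are isomorphic as pseudo-product graded Lie
algebras. -/
theorem free_pp_fgla_exists_unique (m n μ : ℕ) (hm : 1 ≤ m) (hn : 1 ≤ n) (hμ : 2 ≤ μ) :
    Nonempty (FreePPFGLAPkg m n μ) ∧
    ∀ (L : Type) [LieRing L] [LieAlgebra ℂ L] (L' : Type) [LieRing L'] [LieAlgebra ℂ L']
      (G : GLA L) (e f : Submodule ℂ L) (G' : GLA L') (e' f' : Submodule ℂ L'),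
      IsFreePPFGLA G e f m n μ → IsFreePPFGLA G' e' f' m n μ →
      ∃ E : L ≃ₗ⁅ℂ⁆ L',
        (∀ p : ℤ, (G.g p).map (E : L →ₗ⁅ℂ⁆ L').toLinearMap = G'.g p) ∧
        e.map (E : L →ₗ⁅ℂ⁆ L').toLinearMap = e' ∧
        f.map (E : L →ₗ⁅ℂ⁆ L').toLinearMap = f' := by
  refine ⟨⟨⟨_, _, _, _, FreePP.isFreePPFGLA hm hn (by omega : 1 ≤ μ)⟩⟩, ?_⟩
  intro L _ _ L' _ _ G e f G' e' f' h h'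
  exact h.exists_equiv h'
end

section
/- Let (m; e, f) be a free pseudo-product fundamental graded Lie algebra of type (m, n, μ) over ℂ, and let Der(m; e, f)_0 be the Lie algebra of all derivations of m preserving the gradation of m and preserving e and f. Then the map Φ: Der(m; e, f)_0 → gl(e) × gl(f) given by D ↦ (D|e, D|f) is a Lie algebra isomorphism. -/
open scoped TensorProduct

theorem span_isIdempotentElem_end_eq_top (K V : Type*) [Field K] [AddCommGroup V] [Module K V]
    [FiniteDimensional K V] :
    Submodule.span K {P : Module.End K V | IsIdempotentElem P} = ⊤ := by
  set S := Submodule.span K {P : Module.End K V | IsIdempotentElem P} with hS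
  have idem : ∀ (φ : Module.Dual K V) (v : V), φ v = 1 → φ.smulRight v ∈ S := by
    intro φ v h
    refine Submodule.subset_span ?_
    ext x
    simp [h]
  have rank_one : ∀ (φ : Module.Dual K V) (v : V), φ.smulRight v ∈ S := by
    intro φ v
    by_cases hφ : φ = 0
    · have : φ.smulRight v = 0 := by ext x; simp [hφ]
      rw [this]
      exact S.zero_mem
    obtain ⟨w, hw⟩ : ∃ w, φ w = 1 := by
      obtain ⟨u, hu⟩ : ∃ u, φ u ≠ 0 := by
        by_contra! h
        exact hφ (LinearMap.ext h)
      exact ⟨(φ u)⁻¹ • u, by simp [hu]⟩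
    by_cases hv : φ v = 0
    · have : φ.smulRight v = φ.smulRight (v + w) - φ.smulRight w := by
        ext x; simp
      rw [this]
      exact S.sub_mem (idem _ _ (by simp [hv, hw])) (idem _ _ hw)
    · have : φ.smulRight v = φ v • φ.smulRight ((φ v)⁻¹ • v) := by
        ext x
        simp only [LinearMap.smulRight_apply, LinearMap.smul_apply, smul_smul]
        congr 1
        field_simp
      rw [this]
      exact S.smul_mem _ (idem _ _ (by simp [hv]))
  rw [eq_top_iff]
  intro A _
  let b := Module.finBasis K V
  have : A = ∑ i, (b.coord i).smulRight (A (b i)) := by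
    refine b.ext fun j => ?_
    simp [LinearMap.sum_apply, Finsupp.single_apply, ite_smul]
  rw [this]
  exact S.sum_mem fun i _ => rank_one _ _

section

variable {L : Type} [LieRing L] [LieAlgebra ℂ L]

theorem GLA.IsFGLA.eq_top_of_le {G : GLA L} (hG : G.IsFGLA) (K : Submodule ℂ L)
    (h₁ : G.g (-1) ≤ K) (h : ∀ x ∈ K, ∀ y ∈ G.g (-1), ⁅x, y⁆ ∈ K) : K = ⊤ := by
  have key : ∀ k : ℕ, G.g (-1 - (k : ℤ)) ≤ K := by
    intro k
    induction k with
    | zero => simpa using h₁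
    | succ k ih =>
      have e : (-1 - ((k + 1 : ℕ) : ℤ)) = (-1 - (k : ℤ)) - 1 := by push_cast; ring
      rw [e, hG.generated _ (by lia), Submodule.span_le]
      rintro _ ⟨x, hx, y, hy, rfl⟩
      exact h x (ih hx) y hy
  rw [eq_top_iff, ← G.internal.submodule_iSup_eq_top]
  refine iSup_le fun p => ?_
  rcases le_or_gt 0 p with hp | hp
  · simp [hG.nonneg p hp]
  · have := key (-1 - p).toNat
    rwa [show -1 - (((-1 - p).toNat : ℕ) : ℤ) = p by lia] at this

/-- The derivations of degree zero preserving `e` and `f`. -/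
def GLA.ppDerivations (G : GLA L) (e f : Submodule ℂ L) :
    Submodule ℂ (LieDerivation ℂ L L) where
  carrier := {D | (∀ p : ℤ, ∀ x ∈ G.g p, D x ∈ G.g p) ∧
    (∀ x ∈ e, D x ∈ e) ∧ (∀ x ∈ f, D x ∈ f)}
  zero_mem' := by simp
  add_mem' := by
    rintro D E ⟨hD, hDe, hDf⟩ ⟨hE, hEe, hEf⟩
    exact ⟨fun p x hx => add_mem (hD p x hx) (hE p x hx),
      fun x hx => add_mem (hDe x hx) (hEe x hx), fun x hx => add_mem (hDf x hx) (hEf x hx)⟩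
  smul_mem' := by
    rintro c D ⟨hD, hDe, hDf⟩
    exact ⟨fun p x hx => Submodule.smul_mem _ c (hD p x hx),
      fun x hx => Submodule.smul_mem _ c (hDe x hx), fun x hx => Submodule.smul_mem _ c (hDf x hx)⟩

/-- If a Lie algebra is spanned by eigenvectors of an endomorphism `Φ` with eigenvalues powers of
two, then taking exponents of the eigenvalues is a derivation, and it is a polynomial in `Φ`. -/
theorem LieHom.exists_derivation_log [FiniteDimensional ℂ L] (Φ : L →ₗ⁅ℂ⁆ L)
    (hΦ : Submodule.span ℂ {x : L | ∃ k : ℕ, Φ x = (2 : ℂ) ^ k • x} = ⊤) :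
    ∃ D : LieDerivation ℂ L L,
      (∀ (k : ℕ) (x : L), Φ x = (2 : ℂ) ^ k • x → D x = (k : ℂ) • x) ∧
      ∀ K : Submodule ℂ L, (∀ x ∈ K, Φ x ∈ K) → ∀ x ∈ K, D x ∈ K := by
  let F : Module.End ℂ L := (Φ : L →ₗ[ℂ] L)
  have hinj : Function.Injective fun k : ℕ => (2 : ℂ) ^ k := by
    intro a b h
    have h' : (2 : ℂ) ^ a = (2 : ℂ) ^ b := h
    have : (2 : ℕ) ^ a = 2 ^ b := by exact_mod_cast h'
    exact Nat.pow_right_injective le_rfl this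
  have hfin : {k : ℕ | F.HasEigenvalue ((2 : ℂ) ^ k)}.Finite :=
    (Module.End.finite_hasEigenvalue F).preimage hinj.injOn
  let p : Polynomial ℂ := Lagrange.interpolate hfin.toFinset (fun k : ℕ => (2 : ℂ) ^ k)
    (fun k : ℕ => (k : ℂ))
  let D := Polynomial.aeval F p
  have hD : ∀ (k : ℕ) (x : L), Φ x = (2 : ℂ) ^ k • x → D x = (k : ℂ) • x := by
    intro k x hx
    by_cases hx0 : x = 0
    · simp [hx0]
    have hv : F.HasEigenvector ((2 : ℂ) ^ k) x :=
      ⟨Module.End.mem_eigenspace_iff.2 hx, hx0⟩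
    rw [Module.End.aeval_apply_of_hasEigenvector hv]
    congr 1
    exact Lagrange.eval_interpolate_at_node _ hinj.injOn
      (hfin.mem_toFinset.2 (Module.End.hasEigenvalue_of_hasEigenvector hv))
  have leib : ∀ x y : L, D ⁅x, y⁆ = ⁅x, D y⁆ - ⁅y, D x⁆ := by
    intro x y
    have hx : x ∈ Submodule.span ℂ {x : L | ∃ k : ℕ, Φ x = (2 : ℂ) ^ k • x} := hΦ ▸ trivial
    have hy : y ∈ Submodule.span ℂ {x : L | ∃ k : ℕ, Φ x = (2 : ℂ) ^ k • x} := hΦ ▸ trivial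
    induction hx, hy using Submodule.span_induction₂ with
    | mem_mem x y hx hy =>
      obtain ⟨a, ha⟩ := hx
      obtain ⟨b, hb⟩ := hy
      rw [hD a x ha, hD b y hb, hD (a + b) ⁅x, y⁆
        (by rw [LieHom.map_lie, ha, hb, smul_lie, lie_smul, smul_smul, pow_add])]
      rw [lie_smul, lie_smul, ← lie_skew x y]
      push_cast
      module
    | zero_left y hy => simp
    | zero_right x hx => simp
    | add_left x y z _ _ _ h₁ h₂ =>
      simp only [add_lie, lie_add, map_add, h₁, h₂]; abel
    | add_right x y z _ _ _ h₁ h₂ =>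
      simp only [add_lie, lie_add, map_add, h₁, h₂]; abel
    | smul_left r x y _ _ h =>
      simp only [smul_lie, lie_smul, map_smul, h, smul_sub]
    | smul_right r x y _ _ h =>
      simp only [smul_lie, lie_smul, map_smul, h, smul_sub]
  refine ⟨⟨D, leib⟩, hD, fun K hK x hx => ?_⟩
  exact Polynomial.aeval_apply_smul_mem_of_le_comap hx p F hK

/-- Idempotents of `e ⊕ f` preserving `e` and `f` extend to derivations. -/
theorem IsFreePPFGLA.exists_derivation_of_idempotent {G : GLA L} {e f : Submodule ℂ L}
    {m n μ : ℕ} (hfree : IsFreePPFGLA G e f m n μ) (P : L →ₗ[ℂ] L)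
    (he : ∀ x ∈ e, P x ∈ e) (hf : ∀ x ∈ f, P x ∈ f) (hP : IsIdempotentElem P) :
    ∃ D ∈ G.ppDerivations e f, ∀ x ∈ G.g (-1), D x = P x := by
  obtain ⟨hpp, hk, -, -, univ⟩ := hfree
  have := hpp.fgla.fd
  have hPP : ∀ x, P (P x) = P x := fun x => LinearMap.congr_fun hP.eq x
  have hV : ∀ x ∈ G.g (-1), P x ∈ G.g (-1) := by
    rw [← hpp.sup_eq]
    intro x hx
    obtain ⟨a, ha, b, hb, rfl⟩ := Submodule.mem_sup.1 hx
    rw [map_add]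
    exact Submodule.add_mem_sup (he a ha) (hf b hb)
  let φ : G.g (-1) →ₗ[ℂ] G.g (-1) := LinearMap.id + P.restrict hV
  have hφ : ∀ x, ((φ x : G.g (-1)) : L) = x + P x := fun x => rfl
  have hsurj : Function.Surjective φ := by
    intro y
    refine ⟨y - (2⁻¹ : ℂ) • P.restrict hV y, Subtype.ext ?_⟩
    rw [hφ]
    simp only [Submodule.coe_sub, Submodule.coe_smul, LinearMap.coe_restrict_apply, map_sub,
      map_smul, hPP]
    module
  obtain ⟨Φ, ⟨hgr, -, hext⟩, -⟩ := univ L G e f hpp hk φ hsurj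
    (fun x hx hxe => by rw [hφ]; exact add_mem hxe (he x hxe))
    (fun x hx hxf => by rw [hφ]; exact add_mem hxf (hf x hxf))
  have hΦ : ∀ x ∈ G.g (-1), Φ x = x + P x := fun x hx => hext ⟨x, hx⟩
  have fix : ∀ x ∈ G.g (-1), Φ (P x) = (2 : ℂ) ^ 1 • P x := fun x hx => by
    rw [hΦ _ (hV x hx), hPP]; module
  have fix' : ∀ x ∈ G.g (-1), Φ (x - P x) = (2 : ℂ) ^ 0 • (x - P x) := fun x hx => by
    rw [hΦ _ (sub_mem hx (hV x hx)), map_sub, hPP]; module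
  set S := {x : L | ∃ k : ℕ, Φ x = (2 : ℂ) ^ k • x}
  have hg : G.g (-1) ≤ Submodule.span ℂ S := fun x hx => by
    rw [← add_sub_cancel (P x) x]
    exact add_mem (Submodule.subset_span ⟨1, fix x hx⟩) (Submodule.subset_span ⟨0, fix' x hx⟩)
  have htop : Submodule.span ℂ S = ⊤ := by
    refine hpp.fgla.eq_top_of_le _ hg fun x hx y hy => ?_
    replace hy := hg hy
    induction hx, hy using Submodule.span_induction₂ with
    | mem_mem x y hx hy =>
      obtain ⟨a, ha⟩ := hx
      obtain ⟨b, hb⟩ := hy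
      exact Submodule.subset_span ⟨a + b,
        by rw [LieHom.map_lie, ha, hb, smul_lie, lie_smul, smul_smul, pow_add]⟩
    | zero_left y hy => simp
    | zero_right x hx => simp
    | add_left x y z _ _ _ h₁ h₂ => rw [add_lie]; exact add_mem h₁ h₂
    | add_right x y z _ _ _ h₁ h₂ => rw [lie_add]; exact add_mem h₁ h₂
    | smul_left r x y _ _ h => rw [smul_lie]; exact Submodule.smul_mem _ _ h
    | smul_right r x y _ _ h => rw [lie_smul]; exact Submodule.smul_mem _ _ h
  have hge : e ≤ G.g (-1) := hpp.sup_eq ▸ le_sup_left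
  have hgf : f ≤ G.g (-1) := hpp.sup_eq ▸ le_sup_right
  obtain ⟨D, hD, hK⟩ := Φ.exists_derivation_log htop
  refine ⟨D, ⟨fun p => hK _ (hgr p),
    hK e fun x hx => ?_, hK f fun x hx => ?_⟩, fun x hx => ?_⟩
  · rw [hΦ x (hge hx)]; exact add_mem hx (he x hx)
  · rw [hΦ x (hgf hx)]; exact add_mem hx (hf x hx)
  · have h₁ := hD 1 _ (fix x hx)
    have h₀ := hD 0 _ (fix' x hx)
    rw [← add_sub_cancel (P x) x, map_add, h₁, h₀]
    simp

theorem IsFreePPFGLA.symm {G : GLA L} {e f : Submodule ℂ L} {m n μ : ℕ}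
    (hfree : IsFreePPFGLA G e f m n μ) : IsFreePPFGLA G f e n m μ := by
  have swap : ∀ {L' : Type} [LieRing L'] [LieAlgebra ℂ L'] {G' : GLA L'}
      {e' f' : Submodule ℂ L'}, IsPPFGLA G' e' f' → IsPPFGLA G' f' e' := fun h =>
    ⟨h.fgla, h.f_ne_bot, h.e_ne_bot, (sup_comm _ _).trans h.sup_eq, (inf_comm _ _).trans h.inf_eq,
      h.lie_ff, h.lie_ee⟩
  obtain ⟨hpp, hk, hm, hn, univ⟩ := hfree
  exact ⟨swap hpp, hk, hn, hm, fun L' _ _ G' e' f' h' hk' φ hφ hf he =>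
    univ L' G' f' e' (swap h') hk' φ hφ he hf⟩

theorem GLA.ppDerivations_comm (G : GLA L) (e f : Submodule ℂ L) :
    G.ppDerivations e f = G.ppDerivations f e :=
  Submodule.ext fun _ => and_congr_right fun _ => and_comm

/-- Endomorphisms of `e` extend to derivations vanishing on `f`. -/
theorem IsFreePPFGLA.exists_derivation_left {G : GLA L} {e f : Submodule ℂ L}
    {m n μ : ℕ} (hfree : IsFreePPFGLA G e f m n μ) (A : Module.End ℂ e) :
    ∃ D ∈ G.ppDerivations e f, (∀ x : e, D (x : L) = A x) ∧ ∀ x ∈ f, D x = 0 := by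
  have hpp := hfree.1
  have := hpp.fgla.fd
  have hge : e ≤ G.g (-1) := hpp.sup_eq ▸ le_sup_left
  have hgf : f ≤ G.g (-1) := hpp.sup_eq ▸ le_sup_right
  obtain ⟨C, hfC, hC⟩ := (disjoint_iff.2 hpp.inf_eq).symm.exists_isCompl
  let q := e.projectionOnto C hC.symm
  have hA : A ∈ Submodule.span ℂ {P : Module.End ℂ e | IsIdempotentElem P} := by
    rw [span_isIdempotentElem_end_eq_top]; trivial
  induction hA using Submodule.span_induction with
  | mem P hP =>
    have hqe : ∀ x : e, q x = x := fun x => Submodule.projectionOnto_apply_left hC.symm x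
    have hqf : ∀ x ∈ f, q x = 0 := fun x hx =>
      (Submodule.projectionOnto_apply_eq_zero_iff hC.symm).2 (hfC hx)
    have hPP : ∀ x, P (P x) = P x := fun x => LinearMap.congr_fun hP.eq x
    obtain ⟨D, hD, h⟩ := hfree.exists_derivation_of_idempotent (e.subtype ∘ₗ P ∘ₗ q)
      (fun x _ => (P (q x)).2) (fun x hx => by simp [hqf x hx])
      (by ext x; simp [hqe, hPP])
    exact ⟨D, hD, fun x => by simp [h x (hge x.2), hqe],
      fun x hx => by simp [h x (hgf hx), hqf x hx]⟩
  | zero => exact ⟨0, zero_mem _, by simp, by simp⟩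
  | add A B _ _ hA hB =>
    obtain ⟨D, hD, hDe, hDf⟩ := hA
    obtain ⟨E, hE, hEe, hEf⟩ := hB
    exact ⟨D + E, add_mem hD hE, fun x => by simp [hDe, hEe],
      fun x hx => by simp [hDf x hx, hEf x hx]⟩
  | smul c A _ hA =>
    obtain ⟨D, hD, hDe, hDf⟩ := hA
    exact ⟨c • D, Submodule.smul_mem _ c hD, fun x => by simp [hDe], fun x hx => by simp [hDf x hx]⟩

end

/-- For a free pseudo-product FGLA `(m; e, f)`, the restriction map
`Der(m; e, f)₀ → gl(e) × gl(f)`, `D ↦ (D|e, D|f)`, is a Lie algebra isomorphism. -/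
theorem free_pp_fgla_derivations_iso {L : Type} [LieRing L] [LieAlgebra ℂ L]
    (G : GLA L) (e f : Submodule ℂ L) (m n μ : ℕ) (hμ : 2 ≤ μ)
    (hfree : IsFreePPFGLA G e f m n μ) :
    ∃ Φ : {D : LieDerivation ℂ L L //
        (∀ p : ℤ, ∀ x ∈ G.g p, D x ∈ G.g p) ∧
        (∀ x ∈ e, D x ∈ e) ∧ (∀ x ∈ f, D x ∈ f)} →
        Module.End ℂ e × Module.End ℂ f,
      (∀ D (x : e), (((Φ D).1 x : L)) = D.1 (x : L)) ∧
      (∀ D (x : f), (((Φ D).2 x : L)) = D.1 (x : L)) ∧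
      Function.Bijective Φ ∧
      (∀ D D' E, E.1 = ⁅D.1, D'.1⁆ →
        (Φ E).1 = ⁅(Φ D).1, (Φ D').1⁆ ∧ (Φ E).2 = ⁅(Φ D).2, (Φ D').2⁆) := by
  have hpp := hfree.1
  refine ⟨fun D => (D.1.toLinearMap.restrict D.2.2.1, D.1.toLinearMap.restrict D.2.2.2),
    fun _ _ => rfl, fun _ _ => rfl, ⟨fun D E h => ?_, fun ⟨A, B⟩ => ?_⟩, fun D D' E h => ?_⟩
  · obtain ⟨he, hf⟩ := Prod.ext_iff.1 h
    have he' : ∀ x ∈ e, D.1 x = E.1 x := fun x hx =>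
      congrArg Subtype.val (LinearMap.congr_fun he ⟨x, hx⟩)
    have hf' : ∀ x ∈ f, D.1 x = E.1 x := fun x hx =>
      congrArg Subtype.val (LinearMap.congr_fun hf ⟨x, hx⟩)
    have hg : G.g (-1) ≤ LinearMap.eqLocus D.1.toLinearMap E.1.toLinearMap := by
      rw [← hpp.sup_eq]
      exact sup_le he' hf'
    have htop := hpp.fgla.eq_top_of_le _ hg fun x hx y hy => by
      have hx' : D.1 x = E.1 x := hx
      have hy' : D.1 y = E.1 y := hg hy
      show D.1 ⁅x, y⁆ = E.1 ⁅x, y⁆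
      rw [LieDerivation.apply_lie_eq_sub, LieDerivation.apply_lie_eq_sub, hx', hy']
    refine Subtype.ext (LieDerivation.ext fun x => ?_)
    have : x ∈ LinearMap.eqLocus D.1.toLinearMap E.1.toLinearMap := htop ▸ trivial
    exact this
  · obtain ⟨D, hD, hDe, hDf⟩ := hfree.exists_derivation_left A
    obtain ⟨E, hE, hEf, hEe⟩ := hfree.symm.exists_derivation_left B
    rw [GLA.ppDerivations_comm] at hE
    refine ⟨⟨D + E, add_mem hD hE⟩, Prod.ext ?_ ?_⟩
    · ext x
      change D (x : L) + E (x : L) = A x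
      rw [hDe, hEe x x.2, add_zero]
    · ext x
      change D (x : L) + E (x : L) = B x
      rw [hEf, hDf x x.2, zero_add]
  · constructor <;> ext x
    · change E.1 (x : L) = D.1 (D'.1 x) - D'.1 (D.1 x)
      rw [h, LieDerivation.commutator_apply]
    · change E.1 (x : L) = D.1 (D'.1 x) - D'.1 (D.1 x)
      rw [h, LieDerivation.commutator_apply]
end
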